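/- arXiv:1612.02216 — 6 statements merged into one kernel-verified Lean document; each statement's English description precedes it below -/
import Mathlib

section
/- Let K be an algebraically closed field, let p be a prime different from the characteristic of K, and let a ≥ 1 be an integer with p^a > 3. Let A be an m×m matrix and B an n×n matrix over K with A^{p^a} = Id and B^{p^a} = Id, and let k and l be the degrees of the minimal polynomials of A and B. Suppose l ≥ k > 1 and k + l > p^a. Then the Kronecker product A ⊗ B is not almost cyclic. -/
open Matrix

/-- A square matrix is *cyclic* if its characteristic polynomial equals its
minimal polynomial. -/
def Matrix.IsCyclicMat {K : Type*} [Field K] {n : Type*} [Fintype n] [DecidableEq n]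
    (M : Matrix n n K) : Prop :=
  M.charpoly = minpoly K M

/-- A square matrix is *almost cyclic* if it is similar to a block-diagonal matrix
`diag (α • 1ₖ, M₁)` with `M₁` cyclic (the block of size `k` may be empty, in which case
the matrix is cyclic, and `M₁` may be empty, in which case the matrix is scalar). -/
def Matrix.IsAlmostCyclic {K : Type*} [Field K] {n : Type*} [Fintype n] [DecidableEq n]
    (M : Matrix n n K) : Prop :=
  ∃ (k m : ℕ) (e : n ≃ (Fin k ⊕ Fin m)) (α : K) (M₁ : Matrix (Fin m) (Fin m) K)
    (P : Matrix n n K), IsUnit P ∧ M₁.IsCyclicMat ∧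
      P * M * P⁻¹ =
        (Matrix.fromBlocks (α • (1 : Matrix (Fin k) (Fin k) K)) 0 0 M₁).submatrix e e

/-- If `M` has finite order invertible in `K` and is almost cyclic, then at most one eigenvalue
has algebraic multiplicity greater than one. -/
theorem Matrix.IsAlmostCyclic.exists_rootMultiplicity_le_one {K : Type*} [Field K] {n : Type*}
    [Fintype n] [DecidableEq n] {M : Matrix n n K} (h : M.IsAlmostCyclic) {N : ℕ}
    (hN : (N : K) ≠ 0) (hM : M ^ N = 1) :
    ∃ α : K, ∀ c, c ≠ α → M.charpoly.rootMultiplicity c ≤ 1 := by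
  obtain ⟨k, m, e, α, M₁, P, ⟨u, rfl⟩, hM₁, heq⟩ := h
  refine ⟨α, fun c hc ↦ ?_⟩
  set D := fromBlocks (α • (1 : Matrix (Fin k) (Fin k) K)) 0 0 M₁ with hD
  have heq' : (u : Matrix n n K) * M * (u⁻¹ : (Matrix n n K)ˣ) = reindexAlgEquiv K K e.symm D := by
    rw [Matrix.coe_units_inv, heq]
    rfl
  have hchar : M.charpoly = (α • (1 : Matrix (Fin k) (Fin k) K)).charpoly * M₁.charpoly := by
    rw [← charpoly_units_conj u M, ← Matrix.coe_units_inv, heq']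
    exact (charpoly_reindex e.symm D).trans (by rw [hD, charpoly_fromBlocks_zero₁₂])
  have hDN : D ^ N = 1 := by
    apply (reindexAlgEquiv K K e.symm).injective
    rw [map_pow, ← heq', map_one, Units.conj_pow, hM]
    simp
  have hM₁N : M₁ ^ N = 1 := by
    rw [hD, fromBlocks_diagonal_pow, ← fromBlocks_one, fromBlocks_inj] at hDN
    exact hDN.2.2.2
  have hsep : M₁.charpoly.Separable := by
    rw [hM₁]
    exact (Polynomial.X_pow_sub_one_separable_iff.mpr hN).of_dvd
      (minpoly.dvd K M₁ (by simp [hM₁N]))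
  have hscal : (α • (1 : Matrix (Fin k) (Fin k) K)).charpoly.rootMultiplicity c = 0 := by
    apply Polynomial.rootMultiplicity_eq_zero
    rw [smul_one_eq_diagonal, charpoly_diagonal]
    simp [Polynomial.IsRoot, sub_eq_zero, hc]
  rw [hchar, Polynomial.rootMultiplicity_mul
    ((charpoly_monic _).mul (charpoly_monic _)).ne_zero, hscal, zero_add]
  exact Polynomial.rootMultiplicity_le_one_of_separable hsep c

/-- Two linearly independent eigenvectors for the same eigenvalue force algebraic multiplicity
at least two. -/
theorem Matrix.two_le_rootMultiplicity_charpoly {K : Type*} [Field K] {n : Type*}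
    [Fintype n] [DecidableEq n] {M : Matrix n n K} {c : K} {v w : n → K}
    (hv : M *ᵥ v = c • v) (hw : M *ᵥ w = c • w) (h : LinearIndependent K ![v, w]) :
    2 ≤ M.charpoly.rootMultiplicity c := by
  have hle := LinearMap.finrank_eigenspace_le (toLin' M) c
  rw [charpoly_toLin'] at hle
  refine le_trans ?_ hle
  have hspan := finrank_span_eq_card h
  rw [Fintype.card_fin] at hspan
  rw [show 2 = _ from hspan.symm]
  apply Submodule.finrank_mono
  rw [Submodule.span_le, Set.range_subset_iff]
  intro i
  fin_cases i <;> simp [hv, hw]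

open Kronecker in
/-- The tensor product of two eigenvectors is an eigenvector for the product eigenvalue. -/
theorem Matrix.kronecker_mulVec_mul {K : Type*} [Field K] {m n : Type*} [Fintype m] [Fintype n]
    {A : Matrix m m K} {B : Matrix n n K} {s t : K} {u : m → K} {v : n → K}
    (hu : A *ᵥ u = s • u) (hv : B *ᵥ v = t • v) :
    (A ⊗ₖ B) *ᵥ (fun x : m × n ↦ u x.1 * v x.2) =
      (s * t) • (fun x : m × n ↦ u x.1 * v x.2) := by
  ext ⟨i, j⟩
  have h1 : ∑ i', A i i' * u i' = s * u i := congrFun hu i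
  have h2 : ∑ j', B j j' * v j' = t * v j := congrFun hv j
  calc ∑ x : m × n, A i x.1 * B j x.2 * (u x.1 * v x.2)
      = (∑ i', A i i' * u i') * ∑ j', B j j' * v j' := by
        rw [Finset.sum_mul_sum, Fintype.sum_prod_type]
        exact Finset.sum_congr rfl fun _ _ ↦ Finset.sum_congr rfl fun _ _ ↦ by ring
    _ = s * t * (u i * v j) := by rw [h1, h2]; ring

/-- Tensor products of the members of two linearly independent pairs are independent. -/
theorem linearIndependent_pair_mul {K : Type*} [Field K] {m n : Type*}
    {u u' : m → K} {v v' : n → K} (hu : LinearIndependent K ![u, u'])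
    (hv : v ≠ 0) (hv' : v' ≠ 0) :
    LinearIndependent K ![fun x : m × n ↦ u x.1 * v x.2, fun x : m × n ↦ u' x.1 * v' x.2] := by
  rw [LinearIndependent.pair_iff] at hu ⊢
  intro a b hab
  have hcol (j : n) : a * v j = 0 ∧ b * v' j = 0 := by
    apply hu
    ext i
    have := congrFun hab (i, j)
    simp only [Pi.add_apply, Pi.smul_apply, smul_eq_mul, Pi.zero_apply] at this ⊢
    linear_combination this
  obtain ⟨j, hj⟩ := Function.ne_iff.mp hv
  obtain ⟨j', hj'⟩ := Function.ne_iff.mp hv'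
  exact ⟨(mul_eq_zero.mp (hcol j).1).resolve_right hj,
    (mul_eq_zero.mp (hcol j').2).resolve_right hj'⟩

open Kronecker in
/-- If a product of eigenvalues of `A` and `B` arises in two ways, then it is an eigenvalue of
`A ⊗ B` of algebraic multiplicity at least two. -/
theorem Matrix.two_le_rootMultiplicity_charpoly_kronecker {K : Type*} [Field K] {m n : Type*}
    [Fintype m] [Fintype n] [DecidableEq m] [DecidableEq n]
    {A : Matrix m m K} {B : Matrix n n K} {s s' t t' : K}
    (hs : (minpoly K A).IsRoot s) (hs' : (minpoly K A).IsRoot s')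
    (ht : (minpoly K B).IsRoot t) (ht' : (minpoly K B).IsRoot t')
    (hne : s ≠ s') (h : s * t = s' * t') :
    2 ≤ (A ⊗ₖ B).charpoly.rootMultiplicity (s * t) := by
  rw [← minpoly_toLin'] at hs hs' ht ht'
  obtain ⟨u, hu⟩ := (Module.End.hasEigenvalue_of_isRoot hs).exists_hasEigenvector
  obtain ⟨u', hu'⟩ := (Module.End.hasEigenvalue_of_isRoot hs').exists_hasEigenvector
  obtain ⟨v, hv⟩ := (Module.End.hasEigenvalue_of_isRoot ht).exists_hasEigenvector
  obtain ⟨v', hv'⟩ := (Module.End.hasEigenvalue_of_isRoot ht').exists_hasEigenvector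
  have hind : LinearIndependent K ![u, u'] := by
    refine Module.End.eigenvectors_linearIndependent' (toLin' A) ![s, s'] ?_ _ ?_
    · intro i j hij
      fin_cases i <;> fin_cases j <;> simp_all [eq_comm]
    · intro i
      fin_cases i
      exacts [hu, hu']
  exact two_le_rootMultiplicity_charpoly
    (kronecker_mulVec_mul hu.apply_eq_smul hv.apply_eq_smul)
    (h ▸ kronecker_mulVec_mul hu'.apply_eq_smul hv'.apply_eq_smul)
    (linearIndependent_pair_mul hind hv.2 hv'.2)

/-- If products of elements of `S` and `T` lie in `U`, and `S * T` has at most one element with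
several representations, then `|S| |T| < |U| + |S|`. -/
theorem Finset.card_mul_card_lt_of_mul_eq_imp {K : Type*} [Field K]
    {S T U : Finset K} (hS : S.Nonempty) (hmul : ∀ s ∈ S, ∀ t ∈ T, s * t ∈ U)
    (hS0 : ∀ s ∈ S, s ≠ 0) {α : K}
    (hinj : ∀ s ∈ S, ∀ s' ∈ S, ∀ t ∈ T, ∀ t' ∈ T, s * t = s' * t' → s * t ≠ α → s = s') :
    S.card * T.card < U.card + S.card := by
  classical
  have hfst (c : K) : Set.InjOn Prod.fst
      (({x ∈ S ×ˢ T | x.1 * x.2 = c} : Finset (K × K)) : Set (K × K)) := by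
    rintro ⟨s, t⟩ h1 ⟨s', t'⟩ h2 (rfl : s = s')
    simp only [Finset.coe_filter, Finset.mem_product, Set.mem_ofPred_eq] at h1 h2
    rw [mul_left_cancel₀ (hS0 s h1.1.1) (h1.2.trans h2.2.symm)]
  have hfib (c : K) : ({x ∈ S ×ˢ T | x.1 * x.2 = c} : Finset (K × K)).card ≤
      1 + if c = α then S.card - 1 else 0 := by
    split_ifs with hc
    · have : ({x ∈ S ×ˢ T | x.1 * x.2 = c} : Finset (K × K)).card ≤ S.card :=
        Finset.card_le_card_of_injOn Prod.fst (fun x hx ↦ by simp_all) (hfst c)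
      omega
    · refine Finset.card_le_one.mpr fun x hx y hy ↦ hfst c hx hy ?_
      simp only [Finset.mem_filter, Finset.mem_product] at hx hy
      exact hinj _ hx.1.1 _ hy.1.1 _ hx.1.2 _ hy.1.2 (hx.2.trans hy.2.symm) (hx.2 ▸ hc)
  have hsum := Finset.card_eq_sum_card_fiberwise (s := S ×ˢ T) (t := U)
    (f := fun x : K × K ↦ x.1 * x.2)
    (fun x hx ↦ hmul _ (Finset.mem_product.mp hx).1 _ (Finset.mem_product.mp hx).2)
  have hbound := Finset.sum_le_sum fun c (_ : c ∈ U) ↦ hfib c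
  rw [Finset.sum_add_distrib, Finset.sum_ite_eq', Finset.card_product] at *
  have := hS.card_pos
  simp only [Finset.sum_const, smul_eq_mul, mul_one] at hbound
  split_ifs at hbound <;> omega

/-- A matrix of finite order invertible in `K` has as many eigenvalues as the degree of its
minimal polynomial. -/
theorem Matrix.card_roots_minpoly_of_pow_eq_one {K : Type*} [Field K] [IsAlgClosed K]
    [DecidableEq K] {n : Type*} [Fintype n] [DecidableEq n] {A : Matrix n n K} {N : ℕ}
    (hN : (N : K) ≠ 0) (hA : A ^ N = 1) :
    (minpoly K A).roots.toFinset.card = (minpoly K A).natDegree := by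
  have hsep : (minpoly K A).Separable :=
    (Polynomial.X_pow_sub_one_separable_iff.mpr hN).of_dvd (minpoly.dvd K A (by simp [hA]))
  rw [Multiset.toFinset_card_of_nodup (Polynomial.nodup_roots hsep)]
  exact (IsAlgClosed.splits _).natDegree_eq_card_roots.symm

/-- The eigenvalues of a matrix of order dividing `N` are `N`-th roots of unity. -/
theorem Matrix.pow_eq_one_of_isRoot_minpoly {K : Type*} [Field K] {n : Type*} [Fintype n]
    [DecidableEq n] {A : Matrix n n K} {N : ℕ} (hA : A ^ N = 1) {s : K}
    (hs : (minpoly K A).IsRoot s) : s ^ N = 1 := by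
  have hdvd : minpoly K A ∣ Polynomial.X ^ N - 1 := minpoly.dvd K A (by simp [hA])
  simpa [Polynomial.IsRoot, sub_eq_zero] using hs.dvd hdvd

open Kronecker in
/-- Over an algebraically closed field `K` of characteristic different from
the prime `p`, if `A, B` satisfy `A^(p^a) = 1`, `B^(p^a) = 1` with `p^a > 3`, and the degrees
`k ≤ l` of their minimal polynomials satisfy `k > 1` and `k + l > p^a`, then `A ⊗ B` is not
almost cyclic. -/
theorem stmt1 {K : Type*} [Field K] [IsAlgClosed K]
    (p : ℕ) (hp : p.Prime) (hchar : ringChar K ≠ p)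
    (a : ℕ) (ha : 1 ≤ a) (hpa : 3 < p ^ a)
    {m n : ℕ} (A : Matrix (Fin m) (Fin m) K) (B : Matrix (Fin n) (Fin n) K)
    (hA : A ^ (p ^ a) = 1) (hB : B ^ (p ^ a) = 1)
    (k l : ℕ) (hk : k = (minpoly K A).natDegree) (hl : l = (minpoly K B).natDegree)
    (hkl : k ≤ l) (hk1 : 1 < k) (hsum : p ^ a < k + l) :
    ¬ (A ⊗ₖ B).IsAlmostCyclic := by
  classical
  intro hac
  set N := p ^ a with hNdef
  have hN : (N : K) ≠ 0 := by
    rw [hNdef, Nat.cast_pow]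
    refine pow_ne_zero _ fun h0 ↦ ?_
    rcases (Nat.dvd_prime hp).mp (ringChar.dvd h0) with h1 | h1
    · exact CharP.ringChar_ne_one h1
    · exact hchar h1
  have hABN : (A ⊗ₖ B) ^ N = 1 := by
    have hpow (i : ℕ) : (A ⊗ₖ B) ^ i = (A ^ i) ⊗ₖ (B ^ i) := by
      induction i with
      | zero => simp
      | succ i ih => rw [pow_succ, ih, ← mul_kronecker_mul, ← pow_succ, ← pow_succ]
    rw [hpow, hA, hB, one_kronecker_one]
  obtain ⟨α, hα⟩ := hac.exists_rootMultiplicity_le_one hN hABN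
  have hA0 := minpoly.ne_zero (Matrix.isIntegral (R := K) A)
  have hB0 := minpoly.ne_zero (Matrix.isIntegral (R := K) B)
  have hS := card_roots_minpoly_of_pow_eq_one hN hA
  have hT := card_roots_minpoly_of_pow_eq_one hN hB
  have hU : (Polynomial.nthRootsFinset N (1 : K)).card ≤ N := by
    rw [Polynomial.nthRootsFinset_def]
    exact (Multiset.toFinset_card_le _).trans (Polynomial.card_nthRoots N 1)
  have hlt := Finset.card_mul_card_lt_of_mul_eq_imp (S := (minpoly K A).roots.toFinset)
    (T := (minpoly K B).roots.toFinset) (U := Polynomial.nthRootsFinset N (1 : K)) (α := α)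
    (Finset.card_pos.mp (by omega))
    (by
      intro s hs t ht
      simp only [Multiset.mem_toFinset, Polynomial.mem_roots hA0, Polynomial.mem_roots hB0] at hs ht
      rw [Polynomial.mem_nthRootsFinset (by omega), mul_pow,
        pow_eq_one_of_isRoot_minpoly hA hs, pow_eq_one_of_isRoot_minpoly hB ht, one_mul])
    (by
      rintro s hs rfl
      simp only [Multiset.mem_toFinset, Polynomial.mem_roots hA0] at hs
      have := pow_eq_one_of_isRoot_minpoly hA hs
      rw [zero_pow (by omega)] at this
      exact zero_ne_one this)
    (by
      intro s hs s' hs' t ht t' ht' h hne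
      simp only [Multiset.mem_toFinset, Polynomial.mem_roots hA0,
        Polynomial.mem_roots hB0] at hs hs' ht ht'
      by_contra hss
      have := two_le_rootMultiplicity_charpoly_kronecker hs hs' ht ht' hss h
      have := hα _ hne
      omega)
  rw [hS, hT, ← hk, ← hl] at hlt
  have hkl' : k * l < N + k := by omega
  have hkN : N ≤ k + 1 := by nlinarith
  nlinarith
end

section
/- Let K be a field of characteristic ℓ (ℓ a prime or ℓ = 0) and let m ≥ n > 1 be integers. Let J_m and J_n denote the unipotent Jordan blocks of sizes m and n over K (matrices with 1 on the main diagonal and on the superdiagonal and 0 elsewhere). Then the Kronecker product J_m ⊗ J_n is almost cyclic if and only if m = n = 2 and ℓ ≠ 2. -/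
open Matrix

/-- The unipotent Jordan block of size `m`: `1` on the diagonal and the superdiagonal,
`0` elsewhere. -/
def jordanBlockOne (K : Type*) [Field K] (m : ℕ) : Matrix (Fin m) (Fin m) K :=
  Matrix.of fun i j => if (i : ℕ) = (j : ℕ) ∨ (i : ℕ) + 1 = (j : ℕ) then 1 else 0

open Module in
/-- An endomorphism whose minimal polynomial has full degree has eigenspaces of dimension at most
one. -/
theorem LinearMap.finrank_ker_sub_one_le_one {K V : Type*} [Field K] [AddCommGroup V] [Module K V]
    [FiniteDimensional K V] (f : V →ₗ[K] V) (hf : finrank K V ≤ (minpoly K f).natDegree) :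
    finrank K (LinearMap.ker (f - 1)) ≤ 1 := by
  by_contra! hlt
  set R := LinearMap.range (f - 1) with hR
  have hmaps : ∀ x ∈ R, f x ∈ R := by
    rintro _ ⟨y, rfl⟩
    exact ⟨f y, by simp⟩
  set h := (f.restrict hmaps).charpoly
  have hdeg : h.natDegree = finrank K R := LinearMap.charpoly_natDegree _
  have hzero : ∀ x : R, Polynomial.aeval f h (x : V) = 0 := by
    intro x
    have h1 : ∀ p : Polynomial K, Polynomial.aeval f p (x : V)
        = ((Polynomial.aeval (f.restrict hmaps) p x : R) : V) := by
      intro p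
      induction p using Polynomial.induction_on' generalizing x with
      | add p q hp hq => simp [hp, hq]
      | monomial n a =>
        simp [Polynomial.aeval_monomial, Module.End.pow_restrict n]
    rw [h1, LinearMap.aeval_self_charpoly]
    simp
  have hann : Polynomial.aeval f (h * (Polynomial.X - 1)) = 0 := by
    ext v
    simpa using hzero ⟨(f - 1) v, v, rfl⟩
  have hmon : (h * (Polynomial.X - 1)).Monic :=
    (LinearMap.charpoly_monic _).mul (by simpa using Polynomial.monic_X_sub_C (1 : K))
  have hle := Polynomial.natDegree_le_of_dvd (minpoly.dvd K f hann) hmon.ne_zero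
  have hX : (Polynomial.X - 1 : Polynomial K).natDegree = 1 := by
    simpa using Polynomial.natDegree_X_sub_C (1 : K)
  have := Polynomial.natDegree_mul_le (p := h) (q := Polynomial.X - 1)
  have := LinearMap.finrank_range_add_finrank_ker (f - 1)
  rw [← hR] at this
  omega

theorem Matrix.IsCyclicMat.not_linearIndependent {K n : Type*} [Field K] [Fintype n]
    [DecidableEq n] {M : Matrix n n K} (hM : M.IsCyclicMat) (u : Fin 2 → n → K)
    (hu : ∀ i, M *ᵥ u i = u i) : ¬ LinearIndependent K u := by
  intro hli
  have hle : Module.finrank K (LinearMap.ker (Matrix.toLin' M - 1)) ≤ 1 := by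
    apply LinearMap.finrank_ker_sub_one_le_one
    rw [Matrix.minpoly_toLin', ← hM, Matrix.charpoly_natDegree_eq_dim, Module.finrank_pi]
  have hspan : Submodule.span K (Set.range u) ≤ LinearMap.ker (Matrix.toLin' M - 1) := by
    rw [Submodule.span_le]
    rintro _ ⟨i, rfl⟩
    simp [hu]
  have := Submodule.finrank_mono hspan
  rw [finrank_span_eq_card hli, Fintype.card_fin] at this
  omega

/-- The kernel and the range of `M - 1` meet in dimension at most one if `M` is almost cyclic. -/
theorem Matrix.IsAlmostCyclic.not_linearIndependent {K n : Type*} [Field K] [Fintype n]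
    [DecidableEq n] {M : Matrix n n K} (hM : M.IsAlmostCyclic) (a v : Fin 2 → n → K)
    (ha : ∀ i, M *ᵥ a i = a i + v i) (hv : ∀ i, M *ᵥ v i = v i) :
    ¬ LinearIndependent K v := by
  obtain ⟨k, m, e, α, M₁, P, hP, hM₁, hPM⟩ := hM
  intro hli
  have hconj : ∀ w z, M *ᵥ w = z →
      (∀ j, α * (P *ᵥ w) (e.symm (.inl j)) = (P *ᵥ z) (e.symm (.inl j))) ∧
      M₁ *ᵥ (fun j => (P *ᵥ w) (e.symm (.inr j))) = fun j => (P *ᵥ z) (e.symm (.inr j)) := by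
    rintro w _ rfl
    have h : (Matrix.fromBlocks (α • (1 : Matrix (Fin k) (Fin k) K)) 0 0 M₁) *ᵥ
        ((P *ᵥ w) ∘ e.symm) = (P *ᵥ (M *ᵥ w)) ∘ e.symm := by
      have h2 : (P * M * P⁻¹) *ᵥ (P *ᵥ w) = P *ᵥ (M *ᵥ w) := by
        rw [Matrix.mulVec_mulVec, Matrix.mulVec_mulVec, Matrix.mul_assoc,
          Matrix.nonsing_inv_mul _ ((Matrix.isUnit_iff_isUnit_det _).1 hP), Matrix.mul_one]
      rw [hPM, Matrix.submatrix_mulVec_equiv] at h2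
      rw [← h2]
      ext i
      simp
    rw [Matrix.fromBlocks_mulVec] at h
    constructor
    · intro j
      simpa [Matrix.smul_mulVec] using congrFun h (.inl j)
    · ext j
      simpa [Function.comp_def] using congrFun h (.inr j)
  have hinl : ∀ i j, (P *ᵥ v i) (e.symm (.inl j)) = 0 := by
    intro i j
    have h1 := (hconj _ _ (ha i)).1 j
    have h2 := (hconj _ _ (hv i)).1 j
    rw [Matrix.mulVec_add, Pi.add_apply] at h1
    set x := (P *ᵥ a i) (e.symm (.inl j))
    set y := (P *ᵥ v i) (e.symm (.inl j))
    have : y * y = 0 := by linear_combination (-y) * h1 + x * h2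
    simpa using this
  refine hM₁.not_linearIndependent (fun i j => (P *ᵥ v i) (e.symm (.inr j)))
    (fun i => (hconj _ _ (hv i)).2) ?_
  rw [Fintype.linearIndependent_iff] at hli ⊢
  intro g hg
  apply hli g
  apply Matrix.mulVec_injective_of_isUnit hP
  rw [Matrix.mulVec_zero]
  ext i
  rw [Fin.sum_univ_two, Matrix.mulVec_add, Matrix.mulVec_smul, Matrix.mulVec_smul]
  obtain ⟨j, rfl⟩ := e.symm.surjective i
  cases j with
  | inl j => simp [hinl]
  | inr j => simpa using congrFun hg j

theorem jordanBlockOne_mulVec_single_zero (K : Type*) [Field K] (m : ℕ) (h : 0 < m) :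
    jordanBlockOne K m *ᵥ Pi.single ⟨0, h⟩ 1 = Pi.single ⟨0, h⟩ 1 := by
  ext i
  simp [jordanBlockOne, Pi.single_apply, Fin.ext_iff]

theorem jordanBlockOne_mulVec_single_succ (K : Type*) [Field K] (m j : ℕ) (h : j + 1 < m) :
    jordanBlockOne K m *ᵥ Pi.single ⟨j + 1, h⟩ 1 =
      Pi.single ⟨j + 1, h⟩ 1 + Pi.single ⟨j, by omega⟩ 1 := by
  ext i
  simp only [Matrix.mulVec_single_one, jordanBlockOne, Matrix.col_apply, Matrix.of_apply,
    Pi.add_apply, Pi.single_apply, Fin.ext_iff]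
  split_ifs <;> first | omega | simp

open Kronecker in
theorem Matrix.kronecker_mulVec_mul_s2 {K l m : Type*} [Field K] [Fintype l] [Fintype m]
    (A : Matrix l l K) (B : Matrix m m K) (x : l → K) (y : m → K) :
    (A ⊗ₖ B) *ᵥ (fun p => x p.1 * y p.2) = fun p => (A *ᵥ x) p.1 * (B *ᵥ y) p.2 := by
  ext p
  simp only [Matrix.mulVec, dotProduct, Matrix.kroneckerMap_apply, Finset.sum_mul_sum,
    Fintype.sum_prod_type]
  exact Finset.sum_congr rfl fun _ _ => Finset.sum_congr rfl fun _ _ => by ring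

open Kronecker in
theorem not_isAlmostCyclic_jordanBlockOne_kronecker {K : Type*} [Field K] {m n : ℕ}
    (hm : 1 < m) (hn : 1 < n) (h : 2 < m ∨ (2 : K) = 0) :
    ¬ ((jordanBlockOne K m) ⊗ₖ (jordanBlockOne K n)).IsAlmostCyclic := by
  intro hM
  let E : (Fin m → K) → (Fin n → K) → Fin m × Fin n → K := fun x y p => x p.1 * y p.2
  let x₀ : Fin m → K := Pi.single ⟨0, by omega⟩ 1
  let x₁ : Fin m → K := Pi.single ⟨1, hm⟩ 1
  let y₀ : Fin n → K := Pi.single ⟨0, by omega⟩ 1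
  let y₁ : Fin n → K := Pi.single ⟨1, hn⟩ 1
  have hx₀ : jordanBlockOne K m *ᵥ x₀ = x₀ := jordanBlockOne_mulVec_single_zero K m _
  have hx₁ : jordanBlockOne K m *ᵥ x₁ = x₁ + x₀ := jordanBlockOne_mulVec_single_succ K m 0 hm
  have hy₀ : jordanBlockOne K n *ᵥ y₀ = y₀ := jordanBlockOne_mulVec_single_zero K n _
  have hy₁ : jordanBlockOne K n *ᵥ y₁ = y₁ + y₀ := jordanBlockOne_mulVec_single_succ K n 0 hn
  obtain ⟨x₂, hx₂⟩ : ∃ x₂, jordanBlockOne K m *ᵥ x₂ = x₂ + (2 : K) • x₁ := by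
    rcases h with h | h
    · refine ⟨(2 : K) • Pi.single ⟨2, h⟩ 1, ?_⟩
      rw [Matrix.mulVec_smul, jordanBlockOne_mulVec_single_succ K m 1 h, smul_add]
    · exact ⟨0, by simp [h]⟩
  have hE : ∀ x y, ((jordanBlockOne K m) ⊗ₖ (jordanBlockOne K n)) *ᵥ E x y =
      E (jordanBlockOne K m *ᵥ x) (jordanBlockOne K n *ᵥ y) :=
    Matrix.kronecker_mulVec_mul_s2 _ _
  refine hM.not_linearIndependent ![E x₁ y₀, E x₁ y₁ - E x₂ y₀]
    ![E x₀ y₀, E x₀ y₁ - E x₁ y₀ + E x₀ y₀] ?_ ?_ ?_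
  · intro i
    fin_cases i
    · simp only [Fin.zero_eta, Matrix.cons_val_zero, hE, hx₁, hy₀]
      ext p
      simp [E]
      ring
    · simp only [Fin.mk_one, Matrix.cons_val_one, Matrix.cons_val_zero, Matrix.mulVec_sub, hE,
        hx₁, hx₂, hy₀, hy₁]
      ext p
      simp [E]
      ring
  · intro i
    fin_cases i
    · simp only [Fin.zero_eta, Matrix.cons_val_zero, hE, hx₀, hy₀]
    · simp only [Fin.mk_one, Matrix.cons_val_one, Matrix.cons_val_zero, Matrix.mulVec_sub,
        Matrix.mulVec_add, hE, hx₀, hx₁, hy₀, hy₁]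
      ext p
      simp [E]
      ring
  · rw [LinearIndependent.pair_iff]
    intro s t hst
    have ht : t = 0 := by
      simpa [E, x₀, x₁, y₀, y₁, Pi.single_apply] using
        congrFun hst (⟨0, by omega⟩, ⟨1, hn⟩)
    subst ht
    refine ⟨?_, rfl⟩
    simpa [E, x₀, y₀] using congrFun hst (⟨0, by omega⟩, ⟨0, by omega⟩)

theorem isCyclicMat_unipotent_three (K : Type*) [Field K] :
    (!![1, 1, 0; 0, 1, 1; 0, 0, 1] : Matrix (Fin 3) (Fin 3) K).IsCyclicMat := by
  set M : Matrix (Fin 3) (Fin 3) K := !![1, 1, 0; 0, 1, 1; 0, 0, 1] with hM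
  have hchar : M.charpoly = (Polynomial.X - Polynomial.C 1) ^ 3 := by
    rw [Matrix.charpoly, Matrix.det_fin_three]
    simp [hM]
    ring
  have hdvd := Matrix.minpoly_dvd_charpoly M
  rw [hchar, dvd_prime_pow (Polynomial.prime_X_sub_C 1)] at hdvd
  obtain ⟨i, hi, hassoc⟩ := hdvd
  have hmin := Polynomial.eq_of_monic_of_associated (minpoly.monic (Matrix.isIntegral M))
    ((Polynomial.monic_X_sub_C 1).pow i) hassoc
  rw [Matrix.IsCyclicMat, hchar, hmin]
  have hann := minpoly.aeval K M
  rw [hmin] at hann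
  rcases hi.lt_or_eq with hlt | rfl
  · exfalso
    have h2 : (M - 1) ^ 2 = 0 := by
      rw [← Nat.sub_add_cancel (Nat.le_of_lt_succ hlt), pow_add]
      have : (M - 1) ^ i = 0 := by simpa using hann
      rw [this, mul_zero]
    have := congrFun (congrFun h2 0) 2
    simp [hM, pow_two, Matrix.mul_apply, Fin.sum_univ_three] at this
  · rfl

open Kronecker in
theorem isAlmostCyclic_jordanBlockOne_two {K : Type*} [Field K] (h : (2 : K) ≠ 0) :
    ((jordanBlockOne K 2) ⊗ₖ (jordanBlockOne K 2)).IsAlmostCyclic := by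
  let e : Fin 2 × Fin 2 ≃ Fin 1 ⊕ Fin 3 :=
    (finProdFinEquiv (m := 2) (n := 2)).trans (finSumFinEquiv (m := 1) (n := 3)).symm
  let P : Matrix (Fin 2 × Fin 2) (Fin 2 × Fin 2) K :=
    (!![0, 1 / 2, -1 / 2, 0; 1 / 2, -1 / 4, -1 / 4, 0; 0, 1 / 2, 1 / 2, 0; 0, 0, 0, 1] :
      Matrix (Fin 4) (Fin 4) K).submatrix finProdFinEquiv finProdFinEquiv
  let Q : Matrix (Fin 2 × Fin 2) (Fin 2 × Fin 2) K :=
    (!![0, 2, 1, 0; 1, 0, 1, 0; -1, 0, 1, 0; 0, 0, 0, 1] :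
      Matrix (Fin 4) (Fin 4) K).submatrix finProdFinEquiv finProdFinEquiv
  have h4 : (4 : K) ≠ 0 := by
    have : (4 : K) = 2 * 2 := by norm_num
    rw [this]
    exact mul_ne_zero h h
  have hPQ : P * Q = 1 := by
    simp only [P, Q, Matrix.submatrix_mul_equiv]
    rw [← Matrix.submatrix_one_equiv (finProdFinEquiv (m := 2) (n := 2))]
    congr 1
    ext i j
    fin_cases i <;> fin_cases j <;>
      simp [Matrix.mul_apply, Fin.sum_univ_four] <;> field_simp <;> norm_num
  have hinv : P⁻¹ = Q := Matrix.inv_eq_right_inv hPQ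
  refine ⟨1, 3, e, 1, !![1, 1, 0; 0, 1, 1; 0, 0, 1], P,
    (Matrix.isUnit_iff_isUnit_det _).2 (Matrix.isUnit_det_of_right_inverse hPQ),
    isCyclicMat_unipotent_three K, ?_⟩
  have hA : (jordanBlockOne K 2) ⊗ₖ (jordanBlockOne K 2) =
      (!![1, 1, 1, 1; 0, 1, 0, 1; 0, 0, 1, 1; 0, 0, 0, 1] :
        Matrix (Fin 4) (Fin 4) K).submatrix finProdFinEquiv finProdFinEquiv := by
    ext ⟨i, i'⟩ ⟨j, j'⟩
    fin_cases i <;> fin_cases i' <;> fin_cases j <;> fin_cases j' <;>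
      simp [jordanBlockOne, finProdFinEquiv]
  have hB : Matrix.fromBlocks ((1 : K) • (1 : Matrix (Fin 1) (Fin 1) K)) 0 0
        !![1, 1, 0; 0, 1, 1; 0, 0, 1] =
      (!![1, 0, 0, 0; 0, 1, 1, 0; 0, 0, 1, 1; 0, 0, 0, 1] :
        Matrix (Fin 4) (Fin 4) K).submatrix finSumFinEquiv finSumFinEquiv := by
    ext (i | i) (j | j) <;> fin_cases i <;> fin_cases j <;> simp [finSumFinEquiv]
  rw [hinv, hA, hB]
  simp only [P, Q, Matrix.submatrix_mul_equiv, Matrix.submatrix_submatrix]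
  have he : finSumFinEquiv (m := 1) (n := 3) ∘ e = finProdFinEquiv (m := 2) (n := 2) := by
    ext x
    simp [e]
  rw [he]
  congr 1
  ext i j
  fin_cases i <;> fin_cases j <;>
    simp [Matrix.mul_apply, Fin.sum_univ_four] <;> field_simp <;> norm_num

open Kronecker in
/-- For `m ≥ n > 1`, the Kronecker product of the unipotent Jordan blocks
`J_m ⊗ J_n` over a field `K` of characteristic `ℓ` is almost cyclic if and only if
`m = n = 2` and `ℓ ≠ 2`. -/
theorem stmt2 {K : Type*} [Field K] (m n : ℕ) (hn : 1 < n) (hmn : n ≤ m) :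
    ((jordanBlockOne K m) ⊗ₖ (jordanBlockOne K n)).IsAlmostCyclic ↔
      (m = 2 ∧ n = 2 ∧ ringChar K ≠ 2) := by
  constructor
  · intro hM
    by_contra hne
    refine not_isAlmostCyclic_jordanBlockOne_kronecker (by omega) hn ?_ hM
    by_cases hm : 2 < m
    · exact .inl hm
    · right
      have hchar : ringChar K = 2 := by
        by_contra hc
        exact hne ⟨by omega, by omega, hc⟩
      have := ringChar.Nat.cast_ringChar (R := K)
      rw [hchar] at this
      exact_mod_cast this
  · rintro ⟨rfl, rfl, h⟩
    exact isAlmostCyclic_jordanBlockOne_two (Ring.two_ne_zero h)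
end

section
/- Let p and r be primes and let a and b be positive integers such that p^a = r^b + 1. Then either p = 2 and b = 1, or r = 2 and a = 1, or p^a = 9. -/
theorem odd_geom_sum {x : ℤ} {n : ℕ} (hx : Odd x) (hn : Odd n) :
    Odd (∑ i ∈ Finset.range n, x ^ i) := by
  obtain ⟨m, rfl⟩ := hn
  induction m with
  | zero => simp
  | succ m ih =>
    rw [show 2 * (m + 1) + 1 = 2 * m + 1 + 1 + 1 by ring, Finset.sum_range_succ,
      Finset.sum_range_succ, add_assoc]
    exact ih.add_even (hx.pow.add_odd hx.pow)

theorem natAbs_pow_sub_one_eq_of_eq_two_pow {x : ℤ} {n m : ℕ} (hx : Odd x) (hn : Odd n)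
    (h : (x ^ n - 1).natAbs = 2 ^ m) : (x ^ n - 1).natAbs = (x - 1).natAbs := by
  have hS := Int.natAbs_odd.mpr (odd_geom_sum hx hn)
  have hmul := congrArg Int.natAbs (geom_sum_mul x n)
  rw [Int.natAbs_mul] at hmul
  have hdvd : (∑ i ∈ Finset.range n, x ^ i).natAbs ∣ 2 ^ m := h ▸ hmul ▸ dvd_mul_right _ _
  have hone := Nat.Coprime.eq_one_of_dvd (hS.coprime_two_right.pow_right m) hdvd
  rw [← hmul, hone, one_mul]

theorem eq_one_of_two_pow_eq_pow_add_one {r a b : ℕ} (hr : 1 < r) (hb : 1 ≤ b)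
    (h : 2 ^ a = r ^ b + 1) : b = 1 := by
  have hrb : r ≤ r ^ b := Nat.le_self_pow (by omega) r
  have ha : 2 ≤ a := by
    by_contra! hlt
    have : 2 ^ a ≤ 2 ^ 1 := Nat.pow_le_pow_right (by norm_num) (by omega)
    omega
  obtain ⟨c, rfl⟩ := Nat.exists_eq_add_of_le ha
  rw [pow_add] at h
  have hodd : Odd r := by
    by_contra hne
    have := (Nat.not_odd_iff_even.mp hne).pow_of_ne_zero (by omega : b ≠ 0)
    obtain ⟨t, ht⟩ := this
    omega
  have hbodd : Odd b := by
    by_contra hne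
    obtain ⟨k, rfl⟩ := Nat.not_odd_iff_even.mp hne
    obtain ⟨t, ht⟩ := hodd.pow (n := k)
    rw [pow_add, ht] at h
    ring_nf at h
    omega
  have hnat : ((-(r : ℤ)) ^ b - 1).natAbs = r ^ b + 1 := by
    rw [hbodd.neg_pow, ← Nat.cast_pow]
    omega
  have key := natAbs_pow_sub_one_eq_of_eq_two_pow (x := -(r : ℤ)) (m := 2 + c)
    (by simpa using hodd) hbodd (by rw [hnat, ← h, pow_add])
  rw [hnat] at key
  exact Nat.pow_right_injective hr (by simp only [pow_one]; omega)

theorem eq_one_or_eq_nine_of_pow_eq_two_pow_add_one {p a b : ℕ} (hp : 1 < p) (ha : 1 ≤ a)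
    (hb : 1 ≤ b) (h : p ^ a = 2 ^ b + 1) : a = 1 ∨ p ^ a = 9 := by
  rcases Nat.even_or_odd a with ⟨k, rfl⟩ | hodd
  · right
    have hk : p ≤ p ^ k := Nat.le_self_pow (by omega) p
    rw [pow_add] at h ⊢
    generalize p ^ k = y at *
    obtain ⟨z, rfl⟩ := Nat.exists_eq_add_of_le (show 1 ≤ y by omega)
    have hmul : z * (z + 2) = 2 ^ b := by linarith
    obtain ⟨i, -, hi⟩ := (Nat.dvd_prime_pow Nat.prime_two).mp (Dvd.intro _ hmul)
    obtain ⟨j, -, hj⟩ := (Nat.dvd_prime_pow Nat.prime_two).mp (Dvd.intro_left _ hmul)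
    have hz : z = 2 := by
      rcases i with _ | _ | i
      · rcases j with _ | j
        · omega
        · rw [pow_succ] at hj
          omega
      · simpa using hi
      · rcases j with _ | _ | j
        · omega
        · omega
        · simp only [pow_succ] at hi hj
          omega
    subst hz
    rfl
  · left
    have hpodd : Odd p := by
      by_contra hne
      obtain ⟨t, ht⟩ := (Nat.not_odd_iff_even.mp hne).pow_of_ne_zero (by omega : a ≠ 0)
      obtain ⟨c, rfl⟩ := Nat.exists_eq_add_of_le hb
      rw [pow_add] at h
      omega
    have hnat : ((p : ℤ) ^ a - 1).natAbs = 2 ^ b := by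
      rw [← Nat.cast_pow, h, Nat.cast_succ, add_sub_cancel_right, Int.natAbs_natCast]
    have key := natAbs_pow_sub_one_eq_of_eq_two_pow (x := (p : ℤ)) (by simpa using hpodd) hodd hnat
    rw [hnat] at key
    exact Nat.pow_right_injective hp (by simp only [pow_one]; omega)

/-- If `p, r` are primes and `a, b ≥ 1` satisfy `p^a = r^b + 1`, then either
`p = 2` and `b = 1`, or `r = 2` and `a = 1`, or `p^a = 9`. -/
theorem stmt3 (p r a b : ℕ) (hp : p.Prime) (hr : r.Prime) (ha : 1 ≤ a) (hb : 1 ≤ b)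
    (h : p ^ a = r ^ b + 1) :
    (p = 2 ∧ b = 1) ∨ (r = 2 ∧ a = 1) ∨ p ^ a = 9 := by
  rcases hp.eq_two_or_odd' with rfl | hpo
  · exact .inl ⟨rfl, eq_one_of_two_pow_eq_pow_add_one hr.one_lt hb h⟩
  rcases hr.eq_two_or_odd' with rfl | hro
  · have := eq_one_or_eq_nine_of_pow_eq_two_pow_add_one hp.one_lt ha hb h
    tauto
  · obtain ⟨s, hs⟩ := hpo.pow (n := a)
    obtain ⟨t, ht⟩ := hro.pow (n := b)
    omega
end

section
/- Let q be a prime power, n > 2, and let g ∈ GL(n,q) be an element of order q^n − 1 (a Singer cycle). Let h ∈ ⟨g⟩ be an element of order p^k for a prime p and k ≥ 1, with ord(h) < ord(g), and suppose that g lies in the subgroup generated by h together with the center Z(GL(n,q)). Then p is odd, p does not divide q − 1, ord(h) = (q^n − 1)/(q − 1), n is an odd prime with n ≠ p, and ⟨h⟩ is a Sylow p-subgroup of GL(n,q). -/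
open Matrix

theorem pred_mul_add_one_lt_pow {x b : ℕ} (hx : 2 ≤ x) (hb : 2 ≤ b) :
    (x - 1) * b + 1 < x ^ b := by
  obtain ⟨y, rfl⟩ : ∃ y, x = y + 1 := ⟨x - 1, by omega⟩
  simp only [Nat.add_sub_cancel]
  have hy : 1 ≤ y := by omega
  induction b, hb using Nat.le_induction with
  | base => nlinarith
  | succ m hm ih =>
    rw [pow_succ]
    nlinarith [Nat.zero_le (y * y * m)]

theorem pow_sub_one_ne_pred_mul_prime_pow {p x b j : ℕ} (hp : p.Prime) (hodd : Odd p)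
    (hx : 2 ≤ x) (hb : 2 ≤ b) (hpx : p ∣ x - 1) : x ^ b - 1 ≠ (x - 1) * p ^ j := by
  intro h
  have := Fact.mk hp
  have hpx' : ¬ p ∣ x := fun hd => hp.one_lt.ne'
    (Nat.dvd_one.mp (by simpa [Nat.sub_sub_self (by omega : 1 ≤ x)] using Nat.dvd_sub hd hpx))
  have hv := padicValNat.pow_sub_pow (x := x) (y := 1) (p := p) hodd (by omega) hpx hpx'
    (n := b) (by omega)
  rw [one_pow, h, padicValNat.mul (by omega) (pow_ne_zero _ hp.ne_zero),
    padicValNat.prime_pow] at hv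
  have hj : j = padicValNat p b := by omega
  have hle : p ^ j ≤ b := hj ▸ Nat.le_of_dvd (by omega) pow_padicValNat_dvd
  have := pred_mul_add_one_lt_pow hx hb
  have := Nat.mul_le_mul_left (x - 1) hle
  omega

theorem even_of_pow_sub_one_eq_pred_mul_even {x b c : ℕ} (hx : 2 ≤ x) (hodd : Odd x)
    (hc : Even c) (h : x ^ b - 1 = (x - 1) * c) : Even b := by
  by_contra hb
  obtain ⟨m, rfl⟩ := Nat.not_even_iff_odd.mp hb
  obtain ⟨r, rfl⟩ := hc
  obtain ⟨s, hs⟩ := Nat.sub_dvd_pow_sub_pow (x ^ 2) 1 m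
  obtain ⟨y, rfl⟩ := hodd
  rw [one_pow, ← pow_mul] at hs
  have h1 : 1 ≤ (2 * y + 1) ^ (2 * m) := Nat.one_le_pow _ _ (by omega)
  have h3 : (2 * y + 1) ^ (2 * m) = (4 * y * (y + 1)) * s + 1 := by
    have : (2 * y + 1) ^ 2 - 1 = 4 * y * (y + 1) := by
      rw [Nat.sub_eq_iff_eq_add (Nat.one_le_pow _ _ (by omega))]; ring
    rw [this] at hs; omega
  have hy : 0 < y := by omega
  have h2 : (2 * y) * (2 * ((y + 1) * s) * (2 * y + 1) + 1) = 2 * y * (r + r) := by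
    rw [pow_succ, h3] at h
    simp only [Nat.add_sub_cancel] at h
    rw [← h]
    symm
    rw [Nat.sub_eq_iff_eq_add (by nlinarith [Nat.zero_le (4 * y * (y + 1) * s)])]
    ring
  have h4 := Nat.eq_of_mul_eq_mul_left (by omega) h2
  rw [mul_assoc] at h4
  omega

theorem exists_prime_pow_of_pow_mul_sub_one {p x a b j : ℕ} (hp : p.Prime) (hx : 2 ≤ x)
    (ha : 2 ≤ a) (hb : 2 ≤ b) (h : x ^ (a * b) - 1 = (x - 1) * p ^ j) :
    p ∣ (x ^ a - 1) / (x - 1) ∧ ∃ i, 1 ≤ i ∧ (x ^ a) ^ b - 1 = (x ^ a - 1) * p ^ i := by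
  obtain ⟨u, hu⟩ : x - 1 ∣ x ^ a - 1 := by simpa using Nat.sub_dvd_pow_sub_pow x 1 a
  obtain ⟨v, hv⟩ : x ^ a - 1 ∣ (x ^ a) ^ b - 1 := by
    simpa using Nat.sub_dvd_pow_sub_pow (x ^ a) 1 b
  have huv : u * v = p ^ j := by
    rw [pow_mul, hv, hu, mul_assoc] at h
    exact Nat.eq_of_mul_eq_mul_left (by omega) h
  obtain ⟨i, -, rfl⟩ := (Nat.dvd_prime_pow hp).mp (huv ▸ dvd_mul_right u v)
  obtain ⟨i', -, rfl⟩ := (Nat.dvd_prime_pow hp).mp (huv ▸ dvd_mul_left v (p ^ i))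
  have h1 := pred_mul_add_one_lt_pow hx ha
  have hxa : 2 ≤ x ^ a := by nlinarith
  have h2 := pred_mul_add_one_lt_pow hxa hb
  have hi : i ≠ 0 := by
    rintro rfl
    have := Nat.mul_le_mul_left (x - 1) ha
    simp at hu
    omega
  have hi' : i' ≠ 0 := by
    rintro rfl
    have := Nat.mul_le_mul_left (x ^ a - 1) hb
    simp at hv
    omega
  refine ⟨?_, i', by omega, hv⟩
  rw [hu, Nat.mul_div_cancel_left _ (by omega)]
  exact dvd_pow_self p hi

theorem not_dvd_pow_sub_one_of_prime {p q n m : ℕ} (hn : n.Prime) (hpq : ¬ p ∣ q - 1)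
    (hpn : p ∣ q ^ n - 1) (hm : m ≠ 0) (hmn : m < n) : ¬ p ∣ q ^ m - 1 := by
  intro hd
  have := Nat.dvd_gcd hpn hd
  rw [Nat.pow_sub_one_gcd_pow_sub_one,
    (Nat.coprime_of_lt_prime hm hmn hn).gcd_eq_one, pow_one] at this
  exact hpq this

/-- If `(q ^ n - 1) / (q - 1)` is a power of a prime `p`, with `n > 2`, then `p` is odd, `p` does
not divide `q - 1`, and `n` is a prime different from `p`. -/
theorem prime_of_pow_sub_one_eq_pred_mul_prime_pow {p q n j : ℕ} (hp : p.Prime) (hq : 2 ≤ q)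
    (hn : 2 < n) (hj : 1 ≤ j) (h : q ^ n - 1 = (q - 1) * p ^ j) :
    Odd p ∧ ¬ p ∣ q - 1 ∧ n.Prime ∧ n ≠ p := by
  have hodd : Odd p := by
    refine hp.odd_of_ne_two ?_
    rintro rfl
    have heven : Even (2 ^ j) := (Nat.even_pow.mpr ⟨even_two, by omega⟩)
    rcases Nat.even_or_odd q with hqe | hqo
    · have h1 : Even (q ^ n) := Nat.even_pow.mpr ⟨hqe, by omega⟩
      have h2 : 1 ≤ q ^ n := Nat.one_le_pow _ _ (by omega)
      have h3 : Even (q ^ n - 1) := h ▸ heven.mul_left _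
      rw [Nat.even_sub h2] at h3
      exact absurd (h3.mp h1) (by decide)
    · have hne := even_of_pow_sub_one_eq_pred_mul_even hq hqo heven h
      obtain ⟨m, rfl⟩ := hne.two_dvd
      obtain ⟨-, i, hi, hm⟩ := exists_prime_pow_of_pow_mul_sub_one hp hq le_rfl (by omega) h
      have hq2 : 2 ≤ q ^ 2 := by nlinarith
      have hme := even_of_pow_sub_one_eq_pred_mul_even hq2 hqo.pow
        (Nat.even_pow.mpr ⟨even_two, by omega⟩) hm
      obtain ⟨l, rfl⟩ := hme.two_dvd
      have hd : (q ^ 2) ^ 2 - 1 ∣ (q ^ 2) ^ (2 * l) - 1 := by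
        rw [pow_mul]; simpa using Nat.sub_dvd_pow_sub_pow ((q ^ 2) ^ 2) 1 l
      have hf : (q ^ 2) ^ 2 - 1 = (q ^ 2 - 1) * (q ^ 2 + 1) := by
        simpa [mul_comm] using Nat.sq_sub_sq (q ^ 2) 1
      rw [hm, hf] at hd
      have hd' := Nat.dvd_of_mul_dvd_mul_left (by omega) hd
      obtain ⟨t, -, ht⟩ := (Nat.dvd_prime_pow hp).mp hd'
      obtain ⟨y, rfl⟩ := hqo
      have ht' : 2 ≤ t := by
        by_contra hlt
        interval_cases t <;> omega
      obtain ⟨s, rfl⟩ := Nat.exists_eq_add_of_le ht'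
      rw [pow_add] at ht
      ring_nf at ht
      omega
  have hpq : ¬ p ∣ q - 1 := fun hd =>
    pow_sub_one_ne_pred_mul_prime_pow hp hodd hq (by omega) hd h
  refine ⟨hodd, hpq, ?_, ?_⟩
  · by_contra hnp
    obtain ⟨a, ⟨b, rfl⟩, ha, han⟩ := Nat.exists_dvd_of_not_prime2 (by omega) hnp
    have hb : 2 ≤ b := by
      by_contra hb
      interval_cases b <;> omega
    obtain ⟨hd, i, -, hi⟩ := exists_prime_pow_of_pow_mul_sub_one hp hq ha hb h
    refine pow_sub_one_ne_pred_mul_prime_pow hp hodd (by nlinarith [pred_mul_add_one_lt_pow hq ha])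
      hb (hd.trans (Nat.div_dvd_of_dvd ?_)) hi
    simpa using Nat.sub_dvd_pow_sub_pow q 1 a
  · rintro rfl
    have := Fact.mk hp
    have hd : n ∣ q ^ n - 1 := h ▸ (dvd_pow_self n (by omega)).mul_left _
    apply hpq
    rw [← ZMod.natCast_eq_zero_iff, Nat.cast_sub (Nat.one_le_pow _ _ (by omega))] at hd
    rw [← ZMod.natCast_eq_zero_iff, Nat.cast_sub (by omega)]
    simpa using hd

theorem Matrix.GeneralLinearGroup.pow_card_sub_one_eq_one_of_mem_center {n F : Type*} [Fintype n]
    [DecidableEq n] [Field F] [Fintype F] {z : GL n F} (hz : z ∈ Subgroup.center (GL n F)) :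
    z ^ (Fintype.card F - 1) = 1 := by
  rw [center_eq_range_scalar] at hz
  obtain ⟨u, rfl⟩ := hz
  classical
  rw [← map_pow, ← Fintype.card_units, pow_card_eq_one, map_one]

theorem Matrix.factorization_card_GL_of_prime {p n : ℕ} {F : Type*} [Field F] [Fintype F]
    (hp : p.Prime) (hn : n.Prime) (hpF : ¬ p ∣ Fintype.card F - 1)
    (hpn : p ∣ Fintype.card F ^ n - 1) :
    (Nat.card (GL (Fin n) F)).factorization p = (Fintype.card F ^ n - 1).factorization p := by
  set q := Fintype.card F
  have hq : 2 ≤ q := Fintype.one_lt_card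
  obtain ⟨m, rfl⟩ : ∃ m, n = m + 1 := ⟨n - 1, by have := hn.pos; omega⟩
  have hpq : ¬ p ∣ q := fun hd => hp.one_lt.ne' (Nat.dvd_one.mp (by
    simpa [Nat.sub_sub_self (Nat.one_le_pow (m + 1) q (by omega))] using
      Nat.dvd_sub (dvd_pow hd (Nat.succ_ne_zero m)) hpn))
  have hnd : ¬ p ∣ ∏ i : Fin m, (q ^ (m + 1) - q ^ (i.succ : ℕ)) := by
    rw [hp.prime.dvd_finsetProd_iff]
    rintro ⟨i, -, hi⟩
    have hfac : q ^ (m + 1) - q ^ (i.succ : ℕ) = q ^ (i.succ : ℕ) * (q ^ (m - i) - 1) := by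
      rw [Nat.mul_sub, ← pow_add, mul_one, Fin.val_succ]
      congr 2
      omega
    rw [hfac, hp.dvd_mul] at hi
    rcases hi with hi | hi
    · exact hpq (hp.dvd_of_dvd_pow hi)
    · exact not_dvd_pow_sub_one_of_prime hn hpF hpn (by omega) (by omega) hi
  rw [card_GL_field, Fin.prod_univ_succ, Nat.factorization_mul]
  · rw [Finsupp.add_apply, Nat.factorization_eq_zero_of_not_dvd hnd]
    simp [q]
  · have := Nat.one_lt_pow (Nat.succ_ne_zero m) hq
    rw [Fin.val_zero, pow_zero]
    exact Nat.sub_ne_zero_of_lt this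
  · intro h0
    exact hnd (h0 ▸ dvd_zero p)

/-- Let `g ∈ GL(n,q)` (`n > 2`) be a Singer cycle, of order `q^n − 1`, let
`h ∈ ⟨g⟩` be of prime-power order `p^k` with `ord h < ord g`, and suppose `g` lies in the
subgroup generated by `h` and the scalar matrices `Z(GL(n,q))`.  Then `p` is odd, `p ∤ q − 1`,
`ord h = (q^n − 1)/(q − 1)`, `n` is an odd prime different from `p`, and `⟨h⟩` is a Sylow
`p`-subgroup of `GL(n,q)`. -/
theorem stmt15 (n q : ℕ) (hq : IsPrimePow q) (hn : 2 < n)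
    (Fq : Type*) [Field Fq] [Fintype Fq] (hcard : Fintype.card Fq = q)
    (g : GL (Fin n) Fq) (hg : orderOf g = q ^ n - 1)
    (h : GL (Fin n) Fq) (hmem : h ∈ Subgroup.zpowers g)
    (p k : ℕ) (hp : p.Prime) (hk : 1 ≤ k) (hordh : orderOf h = p ^ k)
    (hlt : orderOf h < orderOf g)
    (hgen : g ∈ Subgroup.closure
      ({h} ∪ (Subgroup.center (GL (Fin n) Fq) : Set (GL (Fin n) Fq)))) :
    Odd p ∧ ¬ p ∣ (q - 1) ∧ orderOf h = (q ^ n - 1) / (q - 1) ∧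
      n.Prime ∧ Odd n ∧ n ≠ p ∧
      ∃ P : Sylow p (GL (Fin n) Fq), (P : Subgroup (GL (Fin n) Fq)) = Subgroup.zpowers h := by
  have hq2 : 2 ≤ q := hcard ▸ Fintype.one_lt_card
  have hdvd : q - 1 ∣ q ^ n - 1 := by simpa using Nat.sub_dvd_pow_sub_pow q 1 n
  rw [Subgroup.closure_union, ← Subgroup.zpowers_eq_closure, Subgroup.closure_eq,
    Subgroup.mem_sup_of_normal_right] at hgen
  obtain ⟨y, ⟨m, rfl⟩, z, hz, rfl⟩ := hgen
  set g := h ^ m * z with hgdef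
  have hgq : g ^ (q - 1) = (h ^ m) ^ (q - 1) := by
    have hc : Commute (h ^ m) z := Subgroup.mem_center_iff.mp hz (h ^ m)
    rw [hgdef, hc.mul_pow, ← hcard,
      GeneralLinearGroup.pow_card_sub_one_eq_one_of_mem_center hz, mul_one]
  have hord : orderOf (g ^ (q - 1)) = (q ^ n - 1) / (q - 1) := by
    rw [orderOf_pow_of_dvd (by omega) (hg ▸ hdvd), hg]
  have hSk : (q ^ n - 1) / (q - 1) ∣ p ^ k := by
    rw [← hord, hgq, ← hordh]
    exact (orderOf_pow_dvd _).trans (orderOf_dvd_of_mem_zpowers ⟨m, rfl⟩)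
  obtain ⟨j, hjk, hj⟩ := (Nat.dvd_prime_pow hp).mp hSk
  have hS : q ^ n - 1 = (q - 1) * p ^ j := by rw [← hj, Nat.mul_div_cancel' hdvd]
  have hj1 : 1 ≤ j := by
    by_contra hj0
    obtain rfl : j = 0 := by omega
    have h1 := pred_mul_add_one_lt_pow hq2 hn.le
    have := Nat.mul_le_mul_left (q - 1) hn.le
    rw [pow_zero, mul_one] at hS
    omega
  obtain ⟨hodd, hpq, hnp, hne⟩ := prime_of_pow_sub_one_eq_pred_mul_prime_pow hp hq2 hn hj1 hS
  have hkj : p ^ k ∣ p ^ j := by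
    refine (Nat.Coprime.pow_left k ((hp.coprime_iff_not_dvd).mpr hpq)).dvd_of_dvd_mul_left ?_
    rw [← hS, ← hordh, ← hg]
    exact orderOf_dvd_of_mem_zpowers hmem
  obtain rfl : k = j := le_antisymm ((Nat.pow_dvd_pow_iff_le_right hp.one_lt).mp hkj) hjk
  refine ⟨hodd, hpq, hordh.trans hj.symm, hnp, hnp.odd_of_ne_two (by omega), hne, ?_⟩
  have := Fact.mk hp
  refine ⟨Sylow.ofCard (Subgroup.zpowers h) ?_, rfl⟩
  subst hcard
  rw [Nat.card_zpowers, hordh, factorization_card_GL_of_prime hp hnp hpq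
    (hS ▸ (dvd_pow_self p (by omega)).mul_left _), hS,
    Nat.factorization_mul (by omega) (pow_ne_zero _ hp.ne_zero)]
  simp [Nat.factorization_eq_zero_of_not_dvd hpq, hp.factorization_self]
end

section
/- Let q be an odd prime power, n > 1, and let G = Sp(2n,q) be the symplectic group of degree 2n over 𝔽_q. Let g ∈ G be an element with ord(g) = q^n + 1 or ord(g) = q^n − 1 (a Singer or Singer-type cycle). Let h ∈ ⟨g⟩ be an element of order p^k for a prime p and k ≥ 1, with ord(h) < ord(g), and suppose that g lies in the subgroup generated by h together with the center Z(G). Then p is odd, ⟨h⟩ is a Sylow p-subgroup of G, and one of the following holds: (1) ord(g) = q^n + 1, ord(h) = (q^n + 1)/2, and n is a power of 2; (2) ord(g) = q^n − 1, q = 3, ord(h) = (3^n − 1)/2, and n is an odd prime with n ≠ p. -/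
open Matrix

theorem pow_padicValNat_le {p d : ℕ} (hd : d ≠ 0) : p ^ padicValNat p d ≤ d :=
  Nat.le_of_dvd (Nat.pos_of_ne_zero hd) pow_padicValNat_dvd

theorem padicValNat_two_mul_prime_pow {p : ℕ} (hp : p.Prime) (hodd : Odd p) (k : ℕ) :
    padicValNat p (2 * p ^ k) = k := by
  have := Fact.mk hp
  have h2 : ¬ p ∣ 2 := fun h => by
    have := (Nat.prime_dvd_prime_iff_eq hp Nat.prime_two).1 h
    subst this
    exact absurd hodd (by decide)
  rw [padicValNat.mul (by norm_num) (pow_pos hp.pos k).ne', padicValNat.prime_pow,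
    padicValNat.eq_zero_of_not_dvd h2, zero_add]

theorem eq_two_mul_prime_pow_of_dvd {p m k : ℕ} (hp : p.Prime) (hm : Even m)
    (hdvd : m ∣ 2 * p ^ k) : ∃ j, m = 2 * p ^ j := by
  obtain ⟨y, rfl⟩ := hm.two_dvd
  obtain ⟨j, -, rfl⟩ := (Nat.dvd_prime_pow hp).1 (Nat.dvd_of_mul_dvd_mul_left two_pos hdvd)
  exact ⟨j, rfl⟩

theorem two_mul_lt_three_pow {d : ℕ} (hd : 2 ≤ d) : 2 * d + 1 ≤ 3 ^ (d - 1) * 2 := by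
  induction d, hd using Nat.le_induction with
  | base => norm_num
  | succ m hm ih =>
    obtain ⟨t, rfl⟩ : ∃ t, m = t + 1 := ⟨m - 1, by omega⟩
    simp only [Nat.add_sub_cancel] at ih ⊢
    rw [pow_succ]
    omega

/-- If `x ^ d + 1` is twice a power of an odd prime, where `x` and `d` are odd, then `d = 1`. -/
theorem eq_one_of_pow_add_one_eq {p k x d : ℕ} (hp : p.Prime) (hpo : Odd p) (hx : Odd x)
    (hx1 : 1 < x) (hd : Odd d) (h : x ^ d + 1 = 2 * p ^ k) : d = 1 := by
  have := Fact.mk hp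
  by_contra hd1
  have hd3 : 3 ≤ d := by obtain ⟨t, rfl⟩ := hd; omega
  have hx3 : 3 ≤ x := by obtain ⟨t, rfl⟩ := hx; omega
  obtain ⟨j, hj⟩ := eq_two_mul_prime_pow_of_dvd (k := k) hp hx.add_one (by
    rw [← h]; simpa using hd.nat_add_dvd_pow_add_pow x 1)
  have hj0 : j ≠ 0 := by rintro rfl; rw [pow_zero] at hj; omega
  have hpx : p ∣ x + 1 := hj ▸ (dvd_pow_self p hj0).mul_left 2
  have hnx : ¬ p ∣ x := fun h' => hp.one_lt.ne' (Nat.dvd_one.1 ((Nat.dvd_add_right h').1 hpx))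
  have hval := padicValNat.pow_add_pow hpo hpx hnx hd
  rw [one_pow, h, hj, padicValNat_two_mul_prime_pow hp hpo,
    padicValNat_two_mul_prime_pow hp hpo] at hval
  rw [hval, pow_add, ← mul_assoc, ← hj] at h
  have h1 : x ^ d + 1 ≤ (x + 1) * d := h ▸ Nat.mul_le_mul_left _ (pow_padicValNat_le (by omega))
  have h2 : 3 ^ (d - 1) * x ≤ x ^ d := by
    calc 3 ^ (d - 1) * x ≤ x ^ (d - 1) * x := Nat.mul_le_mul_right _ (Nat.pow_le_pow_left hx3 _)
      _ = x ^ d := by rw [← pow_succ]; congr 1; omega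
  have h3 : 2 * d ≤ 3 ^ (d - 1) := by
    have := two_mul_lt_three_pow (d := d - 1) (by omega)
    obtain ⟨t, rfl⟩ : ∃ t, d = t + 3 := ⟨d - 3, by omega⟩
    simp only [show t + 3 - 1 = t + 2 by omega, show t + 2 - 1 = t + 1 by omega] at this ⊢
    rw [pow_succ]
    omega
  nlinarith

/-- If `x ^ d - 1` is twice a power of an odd prime `p` dividing `x - 1`, then `d = 1`. -/
theorem eq_one_of_pow_eq_add_one {p k x d : ℕ} (hp : p.Prime) (hpo : Odd p) (hx : Odd x)
    (hx1 : 1 < x) (hd : d ≠ 0) (hpx : p ∣ x - 1) (h : x ^ d = 2 * p ^ k + 1) : d = 1 := by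
  have := Fact.mk hp
  by_contra hd1
  have hx3 : 3 ≤ x := by obtain ⟨t, rfl⟩ := hx; omega
  have h' : x ^ d - 1 = 2 * p ^ k := by omega
  obtain ⟨j, hj⟩ := eq_two_mul_prime_pow_of_dvd (m := x - 1) (k := k) hp
    (by obtain ⟨t, rfl⟩ := hx; simp) (by
    rw [← h']; simpa using Nat.sub_dvd_pow_sub_pow x 1 d)
  have hnx : ¬ p ∣ x := fun h' =>
    hp.one_lt.ne' (Nat.dvd_one.1 ((Nat.dvd_sub_iff_right (by omega) h').1 hpx))
  have hval := padicValNat.pow_sub_pow hpo hx1 hpx hnx hd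
  rw [one_pow, h', hj, padicValNat_two_mul_prime_pow hp hpo,
    padicValNat_two_mul_prime_pow hp hpo] at hval
  rw [hval, pow_add, ← mul_assoc, ← hj] at h
  have h1 : x ^ d ≤ (x - 1) * d + 1 :=
    h ▸ Nat.add_le_add_right (Nat.mul_le_mul_left _ (pow_padicValNat_le hd)) 1
  have h2 : 3 ^ (d - 1) * x ≤ x ^ d := by
    calc 3 ^ (d - 1) * x ≤ x ^ (d - 1) * x := Nat.mul_le_mul_right _ (Nat.pow_le_pow_left hx3 _)
      _ = x ^ d := by rw [← pow_succ]; congr 1; omega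
  have h3 := two_mul_lt_three_pow (d := d) (by omega)
  obtain ⟨y, rfl⟩ : ∃ y, x = y + 1 := ⟨x - 1, by omega⟩
  simp only [Nat.add_sub_cancel] at h1
  nlinarith

theorem exists_eq_two_pow_of_pow_add_one_eq {p k q n : ℕ} (hp : p.Prime) (hpo : Odd p)
    (hq : Odd q) (hq1 : 1 < q) (hn : n ≠ 0) (h : q ^ n + 1 = 2 * p ^ k) : ∃ s, n = 2 ^ s := by
  obtain ⟨s, d, hd, rfl⟩ := Nat.exists_eq_two_pow_mul_odd hn
  have := eq_one_of_pow_add_one_eq (x := q ^ 2 ^ s) hp hpo hq.pow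
    (Nat.one_lt_pow (by positivity) hq1) hd (by rw [← pow_mul, h])
  exact ⟨s, by rw [this, mul_one]⟩

theorem odd_of_pow_eq_two_mul_prime_pow_add_one {p k q n : ℕ} (hpo : Odd p) (hq : Odd q)
    (h : q ^ n = 2 * p ^ k + 1) : Odd n := by
  by_contra hn
  obtain ⟨m, rfl⟩ := (Nat.not_odd_iff_even.1 hn).two_dvd
  obtain ⟨a, ha⟩ : Odd (q ^ m) := hq.pow
  obtain ⟨b, hb⟩ : Odd (p ^ k) := hpo.pow
  rw [mul_comm, pow_mul, ha, hb] at h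
  have : 4 * (a * a + a) = 4 * b + 2 := by nlinarith
  omega

theorem eq_three_and_prime_of_pow_eq {p k q n : ℕ} (hp : p.Prime) (hpo : Odd p) (hq : Odd q)
    (hq1 : 1 < q) (hn : 1 < n) (h : q ^ n = 2 * p ^ k + 1) : q = 3 ∧ n.Prime ∧ n ≠ p := by
  have h' : q ^ n - 1 = 2 * p ^ k := by omega
  have key : ∀ a b, n = a * b → a ≠ 0 → 1 < b → q ^ a = 3 := by
    rintro a b rfl ha hb
    have hodd : Odd (q ^ a) := hq.pow
    have h1 : 1 < q ^ a := Nat.one_lt_pow ha hq1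
    obtain ⟨j, hj⟩ := eq_two_mul_prime_pow_of_dvd (m := q ^ a - 1) (k := k) hp
      (by obtain ⟨t, ht⟩ := hodd; simp [ht]) (by
      rw [← h', pow_mul]; simpa using Nat.sub_dvd_pow_sub_pow (q ^ a) 1 b)
    rcases eq_or_ne j 0 with rfl | hj0
    · rw [pow_zero] at hj; omega
    · have := eq_one_of_pow_eq_add_one hp hpo hodd h1 (by omega : b ≠ 0)
        (hj ▸ (dvd_pow_self p hj0).mul_left 2) (by rw [← pow_mul, h])
      omega
  have hq3 : q = 3 := by simpa using key 1 n (one_mul n).symm one_ne_zero hn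
  subst hq3
  refine ⟨rfl, ?_, ?_⟩
  · by_contra hnp
    obtain ⟨a, ⟨b, rfl⟩, ha, hab⟩ := Nat.exists_dvd_of_not_prime hn hnp
    have ha0 : a ≠ 0 := by rintro rfl; simp at hn
    have hb : 1 < b := by
      by_contra hb
      interval_cases b <;> simp_all
    have := key a b rfl ha0 hb
    have : a = 1 := Nat.pow_right_injective (by norm_num : 2 ≤ 3)
      (by simpa using this)
    exact ha this
  · rintro rfl
    have := Fact.mk hp
    have hk : k ≠ 0 := by
      rintro rfl
      have := Nat.pow_lt_pow_right (a := 3) (by norm_num) hn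
      rw [pow_zero] at h
      omega
    have hz : ((3 ^ n : ℕ) : ZMod n) = ((2 * n ^ k + 1 : ℕ) : ZMod n) := by rw [h]
    push_cast at hz
    rw [ZMod.pow_card, CharP.cast_eq_zero, zero_pow hk] at hz
    have h2 : ((2 : ℕ) : ZMod n) = 0 := by push_cast; linear_combination hz
    rw [ZMod.natCast_eq_zero_iff, Nat.prime_dvd_prime_iff_eq hp Nat.prime_two] at h2
    subst h2
    exact absurd hpo (by decide)

theorem not_dvd_pow_two_mul_sub_one_of_pow_add_one {p q s i : ℕ} (hp : p.Prime) (hpo : Odd p)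
    (hq : q ≠ 0) (h : p ∣ q ^ 2 ^ s + 1) (hi : 0 < i) (hin : i < 2 ^ s) :
    ¬ p ∣ q ^ (2 * i) - 1 := by
  have := Fact.mk hp
  have := Fact.mk (show 2 < p by have := hp.two_le; obtain ⟨t, rfl⟩ := hpo; omega)
  intro hdvd
  have h1 : (q : ZMod p) ^ 2 ^ s = -1 := by
    rw [← ZMod.natCast_eq_zero_iff] at h
    push_cast at h
    linear_combination h
  have h2 : (q : ZMod p) ^ (2 * i) = 1 := by
    rw [← ZMod.natCast_eq_zero_iff, Nat.cast_sub (Nat.pos_of_ne_zero (pow_ne_zero _ hq))] at hdvd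
    push_cast at hdvd
    linear_combination hdvd
  have ho := orderOf_eq_prime_pow (x := (q : ZMod p)) (n := s) (p := 2)
    (by rw [h1]; exact ZMod.neg_one_ne_one) (by rw [pow_succ, pow_mul, h1]; norm_num)
  have := Nat.le_of_dvd (by omega) (ho ▸ orderOf_dvd_of_pow_eq_one h2)
  rw [pow_succ] at this
  omega

theorem not_dvd_pow_two_mul_sub_one_of_pow_sub_one {p q n i : ℕ} (hn : n.Prime)
    (hno : Odd n) (h : p ∣ q ^ n - 1) (hq1 : ¬ p ∣ q - 1) (hi : 0 < i) (hin : i < n) :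
    ¬ p ∣ q ^ (2 * i) - 1 := by
  intro hdvd
  have hcop : Nat.gcd n (2 * i) = 1 := by
    refine (Nat.Prime.coprime_iff_not_dvd hn).2 fun hd => ?_
    rcases hn.dvd_mul.1 hd with hd | hd
    · rw [(Nat.prime_dvd_prime_iff_eq hn Nat.prime_two).1 hd] at hno
      exact absurd hno (by decide)
    · exact absurd (Nat.le_of_dvd hi hd) (by omega)
  have := Nat.dvd_gcd h hdvd
  rw [Nat.pow_sub_one_gcd_pow_sub_one, hcop, pow_one] at this
  exact hq1 this

/-- A finite-dimensional space with a nondegenerate skew-symmetric form has even dimension. -/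
theorem LinearMap.BilinForm.even_finrank_of_nondegenerate {F V : Type*} [Field F]
    [AddCommGroup V] [Module F V] [FiniteDimensional F V] (h2 : (2 : F) ≠ 0)
    (B : LinearMap.BilinForm F V) (hB : B.Nondegenerate) (hskew : ∀ v w, B v w = -B w v) :
    Even (Module.finrank F V) := by
  by_contra hodd
  rw [Nat.not_even_iff_odd] at hodd
  let b := Module.finBasis F V
  have hdet := (LinearMap.BilinForm.nondegenerate_iff_det_ne_zero b).1 hB
  set M := LinearMap.BilinForm.toMatrix b B with hM
  have hT : Mᵀ = -M := by
    ext i j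
    simp [hM, LinearMap.BilinForm.toMatrix_apply, hskew (b j) (b i)]
  have h := congrArg Matrix.det hT
  rw [Matrix.det_transpose, Matrix.det_neg, Fintype.card_fin, hodd.neg_one_pow] at h
  apply hdet
  have : 2 * M.det = 0 := by linear_combination h
  exact (mul_eq_zero.1 this).resolve_left h2

/-- The invariants of a group of order prime to the characteristic acting by isometries on a
nondegenerate skew-symmetric space form an even-dimensional subspace. -/
theorem Representation.even_finrank_invariants {F G V : Type*} [Field F] [Group G] [Finite G]
    [AddCommGroup V] [Module F V] [FiniteDimensional F V] (h2 : (2 : F) ≠ 0)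
    (hG : (Nat.card G : F) ≠ 0) (ρ : Representation F G V)
    (B : LinearMap.BilinForm F V) (hB : B.Nondegenerate) (hskew : ∀ v w, B v w = -B w v)
    (hinv : ∀ g v w, B (ρ g v) (ρ g w) = B v w) :
    Even (Module.finrank F ρ.invariants) := by
  cases nonempty_fintype G
  rw [Nat.card_eq_fintype_card] at hG
  have hleft : (B.restrict ρ.invariants).SeparatingLeft := by
    rintro ⟨w, hw⟩ hw0
    refine Subtype.ext (hB.1 w fun v => ?_)
    have hs : ∑ g, ρ g v ∈ ρ.invariants := fun x => by
      rw [map_sum]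
      exact Fintype.sum_equiv (Equiv.mulLeft x) _ _ fun g => by simp
    have h := hw0 ⟨_, hs⟩
    have hterm : ∀ g, B w (ρ g v) = B w v := fun g => by
      conv_lhs => rw [← hw g]
      exact hinv g w v
    simp only [LinearMap.BilinForm.restrict_apply, LinearMap.domRestrict_apply, map_sum, hterm,
      Finset.sum_const, Finset.card_univ, nsmul_eq_mul] at h
    exact (mul_eq_zero.1 h).resolve_left hG
  refine LinearMap.BilinForm.even_finrank_of_nondegenerate h2 (B.restrict ρ.invariants)
    ⟨hleft, fun w hw => hleft w fun v => ?_⟩ fun v w => hskew v w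
  rw [← neg_eq_zero, ← hw v]
  exact (hskew v w).symm

/-- A `p`-group acts on a finite module with a number of non-fixed vectors divisible by `p`. -/
theorem Representation.card_modEq_card_invariants {F G V : Type*} {p : ℕ} [Fact p.Prime]
    [Field F] [Group G] [AddCommGroup V] [Module F V] [Finite V] (hG : IsPGroup p G)
    (ρ : Representation F G V) : Nat.card V ≡ Nat.card ρ.invariants [MOD p] := by
  let : MulAction G V :=
    { smul := fun g v => ρ g v
      one_smul := fun v => by change ρ 1 v = v; simp
      mul_smul := fun g h v => by change ρ (g * h) v = ρ g (ρ h v); simp }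
  exact hG.card_modEq_card_fixedPoints V

/-- A faithful isometric `p`-group on a symplectic space over a field with `q` elements is trivial
as soon as it fixes a nonzero vector, if `p` divides `q ^ dim V - 1` but no smaller
`q ^ (2 * i) - 1`. -/
theorem Representation.subsingleton_of_fixed_vector {F G V : Type*} {p : ℕ} [Fact p.Prime]
    [Field F] [Fintype F] [Group G] [Finite G] [AddCommGroup V] [Module F V] [Finite V]
    (h2 : (2 : F) ≠ 0) (hpF : (p : F) ≠ 0) (hG : IsPGroup p G) (ρ : Representation F G V)
    (hρ : Function.Injective ρ)
    (B : LinearMap.BilinForm F V) (hB : B.Nondegenerate) (hskew : ∀ v w, B v w = -B w v)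
    (hinv : ∀ g v w, B (ρ g v) (ρ g w) = B v w) (hpV : p ∣ Nat.card V - 1)
    (hmin : ∀ i, 0 < i → 2 * i < Module.finrank F V → ¬ p ∣ Fintype.card F ^ (2 * i) - 1)
    {v : V} (hv : v ≠ 0) (hfix : ∀ g, ρ g v = v) : Subsingleton G := by
  have heven := Representation.even_finrank_invariants h2 (by
    obtain ⟨m, hm⟩ := IsPGroup.iff_card.1 hG
    rw [hm, Nat.cast_pow]
    exact pow_ne_zero _ hpF) ρ B hB hskew hinv
  have hmod := ρ.card_modEq_card_invariants hG
  obtain ⟨i, hi⟩ := heven.two_dvd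
  have hpos : 0 < Module.finrank F ρ.invariants := by
    have : Nontrivial ρ.invariants :=
      ⟨⟨v, hfix⟩, 0, fun h => hv (congrArg Subtype.val h)⟩
    exact Module.finrank_pos
  have hdvd : p ∣ Fintype.card F ^ (2 * i) - 1 := by
    rw [← hi, ← Nat.card_eq_fintype_card, ← Module.natCard_eq_pow_finrank]
    refine (Nat.modEq_iff_dvd' Nat.card_pos).1 (Nat.ModEq.trans ?_ hmod)
    exact (Nat.modEq_iff_dvd' Nat.card_pos).2 hpV
  have htop : ρ.invariants = ⊤ := by
    apply Submodule.eq_top_of_finrank_eq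
    refine le_antisymm (Submodule.finrank_le _) (not_lt.1 fun hlt => ?_)
    exact hmin i (by omega) (hi ▸ hlt) hdvd
  refine ⟨fun x y => hρ (LinearMap.ext fun w => ?_)⟩
  have hw : w ∈ ρ.invariants := htop ▸ Submodule.mem_top
  rw [hw x, hw y]

/-- If all stabilizers are trivial, then the order of the group divides that of the set. -/
theorem MulAction.card_dvd_card_of_stabilizer_subsingleton {G X : Type*} [Group G] [Finite G]
    [Finite X] [MulAction G X] (h : ∀ x : X, Subsingleton (MulAction.stabilizer G x)) :
    Nat.card G ∣ Nat.card X := by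
  classical
  cases nonempty_fintype G
  cases nonempty_fintype X
  rw [Nat.card_eq_fintype_card, Nat.card_eq_fintype_card,
    MulAction.card_eq_sum_card_group_div_card_stabilizer G X]
  refine Finset.dvd_sum fun ω _ => ?_
  have := h ω.out
  rw [← Nat.card_eq_fintype_card (α := MulAction.stabilizer G ω.out), Nat.card_of_subsingleton 1, Nat.div_one]

/-- Under the hypotheses of `Representation.subsingleton_of_fixed_vector`, a `p`-group acts freely
on the nonzero vectors, so that its order divides their number. -/
theorem Representation.card_dvd_card_sub_one {F G V : Type*} {p : ℕ} [Fact p.Prime]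
    [Field F] [Fintype F] [Group G] [Finite G] [AddCommGroup V] [Module F V] [Finite V]
    (h2 : (2 : F) ≠ 0) (hpF : (p : F) ≠ 0) (hG : IsPGroup p G) (ρ : Representation F G V)
    (hρ : Function.Injective ρ)
    (B : LinearMap.BilinForm F V) (hB : B.Nondegenerate) (hskew : ∀ v w, B v w = -B w v)
    (hinv : ∀ g v w, B (ρ g v) (ρ g w) = B v w) (hpV : p ∣ Nat.card V - 1)
    (hmin : ∀ i, 0 < i → 2 * i < Module.finrank F V → ¬ p ∣ Fintype.card F ^ (2 * i) - 1) :
    Nat.card G ∣ Nat.card V - 1 := by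
  let : MulAction G {v : V // v ≠ 0} :=
    { smul := fun g v => ⟨ρ g v, fun h => v.2 (by
        simpa [← Module.End.mul_apply, ← map_mul] using congrArg (ρ g⁻¹) h)⟩
      one_smul := fun v => Subtype.ext (by change ρ 1 v.1 = v; simp)
      mul_smul := fun g h v => Subtype.ext (by
        change ρ (g * h) v.1 = ρ g (ρ h v); simp) }
  have hcard : Nat.card {v : V // v ≠ 0} = Nat.card V - 1 := by
    classical
    cases nonempty_fintype V
    rw [Nat.card_eq_fintype_card, Nat.card_eq_fintype_card]
    simp [Fintype.card_subtype_compl]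
  rw [← hcard]
  refine MulAction.card_dvd_card_of_stabilizer_subsingleton fun v => ?_
  refine Representation.subsingleton_of_fixed_vector h2 hpF (hG.to_subgroup _)
    (ρ.comp (MulAction.stabilizer G v).subtype)
    (hρ.comp Subtype.val_injective) B hB hskew (fun g => hinv g) hpV hmin v.2 fun g => ?_
  exact congrArg Subtype.val (show (g : G) • v = v from g.2)

/-- The natural representation of the symplectic group on column vectors. -/
def symplecticRep (l R : Type*) [DecidableEq l] [Fintype l] [CommRing R] :
    Representation R (Matrix.symplecticGroup l R) (l ⊕ l → R) :=
  (Matrix.toLinAlgEquiv' : Matrix (l ⊕ l) (l ⊕ l) R ≃ₐ[R] _).toMonoidHom.comp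
    (Matrix.symplecticGroup l R).subtype

section Symplectic

variable {l R : Type*} [DecidableEq l] [Fintype l] [CommRing R]

theorem symplecticRep_apply (A : Matrix.symplecticGroup l R) (v : l ⊕ l → R) :
    symplecticRep l R A v = (A : Matrix (l ⊕ l) (l ⊕ l) R) *ᵥ v := rfl

theorem symplecticRep_injective : Function.Injective (symplecticRep l R) :=
  (Matrix.toLinAlgEquiv' : Matrix (l ⊕ l) (l ⊕ l) R ≃ₐ[R] _).injective.comp Subtype.val_injective

theorem toBilin'_J_symplecticRep (A : Matrix.symplecticGroup l R) (v w : l ⊕ l → R) :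
    Matrix.toBilin' (J l R) (symplecticRep l R A v) (symplecticRep l R A w) =
      Matrix.toBilin' (J l R) v w := by
  simp only [Matrix.toBilin'_apply', symplecticRep_apply]
  conv_rhs => rw [← SymplecticGroup.mem_iff'.1 A.2]
  rw [← Matrix.mulVec_mulVec, ← Matrix.mulVec_mulVec, Matrix.dotProduct_mulVec v,
    Matrix.vecMul_transpose]

theorem toBilin'_J_skew (v w : l ⊕ l → R) :
    Matrix.toBilin' (J l R) v w = -Matrix.toBilin' (J l R) w v := by
  rw [Matrix.toBilin'_apply', Matrix.toBilin'_apply', Matrix.dotProduct_mulVec, dotProduct_comm,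
    ← Matrix.mulVec_transpose, J_transpose, Matrix.neg_mulVec, dotProduct_neg]

theorem fromBlocks_one_zero_one_mem {S : Matrix l l R} (hS : Sᵀ = S) :
    fromBlocks 1 S 0 1 ∈ symplecticGroup l R := by
  simp [SymplecticGroup.mem_iff, J, fromBlocks_multiply, fromBlocks_transpose, hS]

theorem fromBlocks_one_zero_mem {S : Matrix l l R} (hS : Sᵀ = S) :
    fromBlocks 1 0 S 1 ∈ symplecticGroup l R := by
  simp [SymplecticGroup.mem_iff, J, fromBlocks_multiply, fromBlocks_transpose, hS]

/-- Central elements of the symplectic group are involutions. -/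
theorem sq_eq_one_of_mem_center_symplecticGroup {z : symplecticGroup l R}
    (hz : z ∈ Subgroup.center (symplecticGroup l R)) : z ^ 2 = 1 := by
  obtain ⟨M, hM⟩ := z
  obtain ⟨A, B, C, D, rfl⟩ : ∃ A B C D, M = fromBlocks A B C D :=
    ⟨_, _, _, _, (fromBlocks_toBlocks M).symm⟩
  have hU : ∀ S : Matrix l l R, Sᵀ = S → fromBlocks 1 S 0 1 * fromBlocks A B C D =
      fromBlocks A B C D * fromBlocks 1 S 0 1 := fun S hS =>
    congrArg Subtype.val (Subgroup.mem_center_iff.1 hz ⟨_, fromBlocks_one_zero_one_mem hS⟩)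
  have hL : ∀ S : Matrix l l R, Sᵀ = S → fromBlocks 1 0 S 1 * fromBlocks A B C D =
      fromBlocks A B C D * fromBlocks 1 0 S 1 := fun S hS =>
    congrArg Subtype.val (Subgroup.mem_center_iff.1 hz ⟨_, fromBlocks_one_zero_mem hS⟩)
  simp only [fromBlocks_multiply, fromBlocks_inj, one_mul, zero_mul, mul_one, mul_zero, zero_add,
    add_zero] at hU hL
  have hC : C = 0 := by simpa using (hU 1 transpose_one).1
  have hB : B = 0 := by simpa using (hL 1 transpose_one).1.symm
  have hAD : D = A := by simpa [hB] using (hU 1 transpose_one).2.1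
  subst hC hB hAD
  have hcomm : ∀ i, Commute (single i i 1) D := fun i => by
    simpa [Commute, SemiconjBy] using (hU (single i i 1) (transpose_single i i 1)).2.1
  have hT : Dᵀ = D := by
    ext i j
    rcases eq_or_ne i j with rfl | hij
    · rfl
    · rw [transpose_apply, row_eq_zero_of_commute_single (hcomm i) hij.symm,
        row_eq_zero_of_commute_single (hcomm j) hij]
  have hDD : D * D = 1 := by
    have := SymplecticGroup.mem_iff.1 hM
    simpa [J, fromBlocks_multiply, fromBlocks_transpose, hT] using this
  apply Subtype.ext
  simp [pow_two, fromBlocks_multiply, hDD]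

/-- A `p`-subgroup of a symplectic group over a field with `q` elements has order dividing
`q ^ (2 * n) - 1` if `p` divides this number but no smaller `q ^ (2 * i) - 1`. -/
theorem card_dvd_of_isPGroup_symplecticGroup {F : Type*} [Field F] [Fintype F] {p : ℕ}
    [Fact p.Prime] (h2 : (2 : F) ≠ 0) (hpF : (p : F) ≠ 0) {P : Subgroup (symplecticGroup l F)}
    (hP : IsPGroup p P) (hdvd : p ∣ Fintype.card F ^ (2 * Fintype.card l) - 1)
    (hmin : ∀ i, 0 < i → i < Fintype.card l → ¬ p ∣ Fintype.card F ^ (2 * i) - 1) :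
    Nat.card P ∣ Fintype.card F ^ (2 * Fintype.card l) - 1 := by
  have hcard : Nat.card (l ⊕ l → F) = Fintype.card F ^ (2 * Fintype.card l) := by
    rw [Nat.card_eq_fintype_card]
    simp [two_mul]
  rw [← hcard] at hdvd ⊢
  refine Representation.card_dvd_card_sub_one h2 hpF hP ((symplecticRep l F).comp P.subtype)
    (symplecticRep_injective.comp Subtype.val_injective) (toBilin' (J l F))
    (LinearMap.BilinForm.nondegenerate_toBilin'_of_det_ne_zero' _ (isUnit_det_J l F).ne_zero)
    toBilin'_J_skew (fun g => toBilin'_J_symplecticRep g.1) hdvd fun i hi hlt => hmin i hi ?_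
  simp at hlt
  omega

end Symplectic

theorem le_of_pow_dvd_sq_sub_one {p k m Q : ℕ} (hp : p.Prime) (hpo : Odd p)
    (h : Q + 1 = 2 * p ^ k ∨ Q = 2 * p ^ k + 1) (hk : k ≠ 0) (hdvd : p ^ m ∣ Q ^ 2 - 1) :
    m ≤ k := by
  have := Fact.mk hp
  obtain ⟨c, hc, hc0⟩ : ∃ c, Q ^ 2 - 1 = 4 * c * p ^ k ∧ ¬ p ∣ c := by
    have hpk : p ∣ p ^ k := dvd_pow_self p hk
    have hpos : 0 < p ^ k := pow_pos hp.pos k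
    rcases h with h | h
    · refine ⟨p ^ k - 1, ?_, fun hd => hp.one_lt.ne' (Nat.dvd_one.1 ?_)⟩
      · obtain ⟨t, ht⟩ : ∃ t, p ^ k = t + 1 := ⟨p ^ k - 1, by omega⟩
        obtain rfl : Q = 2 * t + 1 := by omega
        rw [ht, Nat.add_sub_cancel]
        apply Nat.sub_eq_of_eq_add
        ring
      · exact (Nat.dvd_sub_iff_right hpos hpk).1 hd
    · refine ⟨p ^ k + 1, ?_, fun hd => hp.one_lt.ne' (Nat.dvd_one.1 ?_)⟩
      · rw [h]
        apply Nat.sub_eq_of_eq_add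
        ring
      · exact (Nat.dvd_add_right hpk).1 hd
  have h4 : Nat.Coprime p 4 := by
    rw [show 4 = 2 ^ 2 by norm_num]
    exact (Nat.coprime_two_right.2 hpo).pow_right 2
  rw [hc] at hdvd
  have hcop : Nat.Coprime p (4 * c) := h4.mul_right ((Nat.Prime.coprime_iff_not_dvd hp).2 hc0)
  exact (Nat.pow_dvd_pow_iff_le_right hp.one_lt).1 ((hcop.pow_left m).dvd_of_dvd_mul_left hdvd)

/-- If `g` is a product of a power of `h`, where `h` has order `p ^ k`, with a central involution,
and `⟨h⟩` is properly contained in `⟨g⟩`, then `p` is odd and `g` has order `2 * p ^ k`. -/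
theorem odd_and_orderOf_eq_two_mul {G : Type*} [Group G]
    (hcenter : ∀ z ∈ Subgroup.center G, z ^ 2 = 1) {g h : G} (hmem : h ∈ Subgroup.zpowers g)
    {p k : ℕ} (hp : p.Prime) (hk : 1 ≤ k) (hordh : orderOf h = p ^ k)
    (hlt : orderOf h < orderOf g)
    (hgen : g ∈ Subgroup.closure ({h} ∪ (Subgroup.center G : Set G))) :
    Odd p ∧ orderOf g = 2 * p ^ k := by
  rw [Subgroup.closure_union, Subgroup.closure_eq, ← Subgroup.zpowers_eq_closure,
    Subgroup.mem_sup_of_normal_right] at hgen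
  obtain ⟨x, hx, z, hz, rfl⟩ := hgen
  have hxz : Commute x z := Subgroup.mem_center_iff.1 hz x
  have hxk : x ^ p ^ k = 1 := orderOf_dvd_iff_pow_eq_one.1 (hordh ▸ orderOf_dvd_of_mem_zpowers hx)
  have hpos : 0 < p ^ k := pow_pos hp.pos k
  have hpo : Odd p := by
    refine hp.odd_of_ne_two ?_
    rintro rfl
    refine absurd (Nat.le_of_dvd hpos (orderOf_dvd_of_pow_eq_one (x := x * z) ?_)) (by omega)
    obtain ⟨t, rfl⟩ : ∃ t, k = t + 1 := ⟨k - 1, by omega⟩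
    rw [hxz.mul_pow, hxk, pow_succ', pow_mul, hcenter z hz, one_pow, one_mul]
  refine ⟨hpo, ?_⟩
  have hdvd : orderOf (x * z) ∣ 2 * p ^ k := orderOf_dvd_of_pow_eq_one (by
    rw [hxz.mul_pow, pow_mul z, hcenter z hz, one_pow, mul_one, mul_comm, pow_mul, hxk, one_pow])
  obtain ⟨c, hc⟩ := hordh ▸ orderOf_dvd_of_mem_zpowers hmem
  rw [hc, mul_comm 2] at hdvd
  rcases (Nat.dvd_prime Nat.prime_two).1 (Nat.dvd_of_mul_dvd_mul_left hpos hdvd) with rfl | rfl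
  · omega
  · rw [hc, mul_comm]

/-- A cyclic `p`-group whose order bounds that of every `p`-subgroup is a Sylow subgroup. -/
theorem exists_sylow_eq_zpowers {G : Type*} [Group G] [Finite G] {p k : ℕ} (hp : p.Prime) {h : G}
    (hordh : orderOf h = p ^ k)
    (hmax : ∀ (P : Subgroup G) (m : ℕ), IsPGroup p P → Nat.card P = p ^ m → m ≤ k) :
    ∃ P : Sylow p G, (P : Subgroup G) = Subgroup.zpowers h := by
  have := Fact.mk hp
  have hcard : Nat.card (Subgroup.zpowers h) = p ^ k := by rw [Nat.card_zpowers, hordh]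
  obtain ⟨P, hP⟩ := (IsPGroup.of_card hcard).exists_le_sylow
  obtain ⟨m, hm⟩ := IsPGroup.iff_card.1 P.isPGroup'
  refine ⟨P, (Subgroup.eq_of_le_of_card_ge hP ?_).symm⟩
  rw [hcard, hm]
  exact Nat.pow_le_pow_right hp.pos (hmax P m P.isPGroup' hm)

/-- Let `G = Sp(2n,q)`, `q` odd, `n > 1`, let `g ∈ G` be a Singer or
Singer-type cycle (of order `q^n + 1` resp. `q^n − 1`), let `h ∈ ⟨g⟩` be of prime-power
order `p^k` with `ord h < ord g`, and suppose `g` lies in the subgroup generated by `h` and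
`Z(G)`.  Then `p` is odd, `⟨h⟩` is a Sylow `p`-subgroup of `G`, and either
`ord g = q^n + 1`, `ord h = (q^n + 1)/2` and `n` is a power of `2`, or `ord g = q^n − 1`,
`q = 3`, `ord h = (3^n − 1)/2` and `n` is an odd prime different from `p`. -/
theorem stmt16 (n q : ℕ) (hq : IsPrimePow q) (hqodd : Odd q) (hn : 1 < n)
    (Fq : Type*) [Field Fq] [Fintype Fq] (hcard : Fintype.card Fq = q)
    (g : Matrix.symplecticGroup (Fin n) Fq)
    (hg : orderOf g = q ^ n + 1 ∨ orderOf g = q ^ n - 1)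
    (h : Matrix.symplecticGroup (Fin n) Fq) (hmem : h ∈ Subgroup.zpowers g)
    (p k : ℕ) (hp : p.Prime) (hk : 1 ≤ k) (hordh : orderOf h = p ^ k)
    (hlt : orderOf h < orderOf g)
    (hgen : g ∈ Subgroup.closure
      ({h} ∪ (Subgroup.center (Matrix.symplecticGroup (Fin n) Fq) :
        Set (Matrix.symplecticGroup (Fin n) Fq)))) :
    Odd p ∧
      (∃ P : Sylow p (Matrix.symplecticGroup (Fin n) Fq),
        (P : Subgroup (Matrix.symplecticGroup (Fin n) Fq)) = Subgroup.zpowers h) ∧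
      ((orderOf g = q ^ n + 1 ∧ orderOf h = (q ^ n + 1) / 2 ∧ ∃ s : ℕ, n = 2 ^ s) ∨
        (orderOf g = q ^ n - 1 ∧ q = 3 ∧ orderOf h = (3 ^ n - 1) / 2 ∧
          n.Prime ∧ Odd n ∧ n ≠ p)) := by
  have hq1 : 1 < q := hq.one_lt
  have hq0 : q ≠ 0 := by omega
  obtain ⟨hpo, hgo⟩ := odd_and_orderOf_eq_two_mul
    (fun z hz => sq_eq_one_of_mem_center_symplecticGroup hz) hmem hp hk hordh hlt hgen
  have hfact := Fact.mk hp
  have hk0 : k ≠ 0 := by omega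
  have hqn : 0 < q ^ n := pow_pos hq.pos n
  have hQ : q ^ n + 1 = 2 * p ^ k ∨ q ^ n = 2 * p ^ k + 1 := by
    have := pow_pos hp.pos k
    omega
  have hqF : (q : Fq) = 0 := hcard ▸ Nat.cast_card_eq_zero Fq
  have h2F : (2 : Fq) ≠ 0 := by
    intro h2
    obtain ⟨t, ht⟩ := hqodd
    rw [ht] at hqF
    push_cast at hqF
    rw [h2, zero_mul, zero_add] at hqF
    exact one_ne_zero hqF
  have hpF : (p : Fq) ≠ 0 := by
    intro hp0
    rcases hQ with h | h <;> have h := congrArg (Nat.cast : ℕ → Fq) h <;>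
    · push_cast at h
      simp [hp0, hqF, hk0, zero_pow (show n ≠ 0 by omega)] at h
  have hpdvd : p ∣ q ^ (2 * n) - 1 := by
    have hpk : p ∣ 2 * p ^ k := (dvd_pow_self p hk0).mul_left 2
    rw [mul_comm, pow_mul, show (q ^ n) ^ 2 - 1 = (q ^ n + 1) * (q ^ n - 1) by
      simpa using Nat.sq_sub_sq (q ^ n) 1]
    rcases hQ with h | h
    · exact (h ▸ hpk).mul_right _
    · exact Dvd.dvd.mul_left (by rwa [h, Nat.add_sub_cancel]) _
  have hconcl : (orderOf g = q ^ n + 1 ∧ orderOf h = (q ^ n + 1) / 2 ∧ ∃ s : ℕ, n = 2 ^ s) ∨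
      (orderOf g = q ^ n - 1 ∧ q = 3 ∧ orderOf h = (3 ^ n - 1) / 2 ∧
        n.Prime ∧ Odd n ∧ n ≠ p) := by
    rcases hg with hg | hg
    · have h1 : q ^ n + 1 = 2 * p ^ k := by omega
      exact Or.inl ⟨hg, by omega,
        exists_eq_two_pow_of_pow_add_one_eq hp hpo hqodd hq1 (by omega) h1⟩
    · have h1 : q ^ n = 2 * p ^ k + 1 := by omega
      obtain ⟨rfl, hnp, hne⟩ := eq_three_and_prime_of_pow_eq hp hpo hqodd hq1 hn h1
      exact Or.inr ⟨hg, rfl, by omega, hnp,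
        odd_of_pow_eq_two_mul_prime_pow_add_one hpo hqodd h1, hne⟩
  have hmin : ∀ i, 0 < i → i < n → ¬ p ∣ q ^ (2 * i) - 1 := by
    intro i hi hin
    have hpk : p ∣ 2 * p ^ k := (dvd_pow_self p hk0).mul_left 2
    rcases hconcl with ⟨hg, -, s, rfl⟩ | ⟨hg, rfl, -, hnp, hno, -⟩
    · exact not_dvd_pow_two_mul_sub_one_of_pow_add_one hp hpo hq0 (by rwa [← hg, hgo]) hi hin
    · refine not_dvd_pow_two_mul_sub_one_of_pow_sub_one hnp hno (by rwa [← hg, hgo]) ?_ hi hin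
      intro h2
      rw [(Nat.prime_dvd_prime_iff_eq hp Nat.prime_two).1 h2] at hpo
      exact absurd hpo (by decide)
  refine ⟨hpo, exists_sylow_eq_zpowers hp hordh fun P m hP hm => ?_, hconcl⟩
  have hdvd := card_dvd_of_isPGroup_symplecticGroup h2F hpF hP
    (by rwa [hcard, Fintype.card_fin]) (by rwa [hcard, Fintype.card_fin])
  rw [hm, hcard, Fintype.card_fin, mul_comm, pow_mul] at hdvd
  exact le_of_pow_dvd_sq_sub_one hp hpo hQ hk0 hdvd
end

section
/- Let q ≥ 3 be an odd prime power and let n ≥ 2 be an integer. Then q^n + 1 is not a prime power; that is, there is no prime p and integer a ≥ 1 with q^n + 1 = p^a. -/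
theorem Odd.two_mul_add_one_dvd_sq_sub_one {q : ℕ} (hq : Odd q) :
    2 * ((q : ℤ) + 1) ∣ (q : ℤ) ^ 2 - 1 := by
  obtain ⟨m, rfl⟩ := hq
  exact ⟨m, by push_cast; ring⟩

theorem Odd.pow_add_one_ne_two_pow {q n : ℕ} (hq : Odd q) (hq3 : 3 ≤ q) (hn : 2 ≤ n) (a : ℕ) :
    q ^ n + 1 ≠ 2 ^ a := by
  intro h
  have hlt : q < q ^ n := lt_self_pow₀ (by omega) (by omega)
  rcases Nat.even_or_odd' n with ⟨k, rfl | rfl⟩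
  · have ha : 2 ≤ a := by
      by_contra! ha
      interval_cases a <;> omega
    have h4 : 4 ∣ q ^ (2 * k) + 1 := h ▸ pow_dvd_pow 2 ha
    have hsq : q ^ 2 % 4 = 1 := by
      rcases (by obtain ⟨m, rfl⟩ := hq; omega : q % 4 = 1 ∨ q % 4 = 3) with h | h <;>
        simp [Nat.pow_mod, h]
    have : q ^ (2 * k) % 4 = 1 := by
      simp [pow_mul, Nat.pow_mod (q ^ 2), hsq]
    omega
  · have hdvd : q + 1 ∣ 2 ^ a := by
      rw [← h]
      simpa using Odd.nat_add_dvd_pow_add_pow q 1 (odd_two_mul_add_one k)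
    obtain ⟨b, -, hb⟩ := (Nat.dvd_prime_pow Nat.prime_two).1 hdvd
    have hba : b < a := (Nat.pow_lt_pow_iff_right one_lt_two).1 (by omega)
    have h1 : 2 * (q + 1) ∣ q ^ (2 * k + 1) + 1 := by
      rw [h, hb, ← pow_succ']
      exact pow_dvd_pow 2 hba
    have h1' : 2 * ((q : ℤ) + 1) ∣ (q : ℤ) ^ (2 * k + 1) + 1 := by exact_mod_cast h1
    have h2 : 2 * ((q : ℤ) + 1) ∣ q * (((q : ℤ) ^ 2) ^ k - 1) :=
      (hq.two_mul_add_one_dvd_sq_sub_one.trans (sub_one_dvd_pow_sub_one _ k)).mul_left _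
    have h3 : 2 * ((q : ℤ) + 1) ∣ (q : ℤ) + 1 := by
      have hsub := dvd_sub h1' h2
      rwa [show (q : ℤ) ^ (2 * k + 1) + 1 - q * (((q : ℤ) ^ 2) ^ k - 1) = q + 1 by ring] at hsub
    have := Int.le_of_dvd (by positivity) h3
    omega

/-- If `q ≥ 3` is an odd prime power and `n ≥ 2`, then `q^n + 1` is not a
prime power. -/
theorem stmt17 (q : ℕ) (hq3 : 3 ≤ q) (hqodd : Odd q)
    (hq : ∃ r c : ℕ, r.Prime ∧ Odd r ∧ 1 ≤ c ∧ q = r ^ c)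
    (n : ℕ) (hn : 2 ≤ n) :
    ¬ ∃ (p a : ℕ), p.Prime ∧ 1 ≤ a ∧ q ^ n + 1 = p ^ a := by
  rintro ⟨p, a, hp, -, h⟩
  have heven : Even (p ^ a) := h ▸ hqodd.pow.add_one
  obtain rfl : p = 2 := hp.even_iff.1 (Nat.even_pow.1 heven).1
  exact hqodd.pow_add_one_ne_two_pow hq3 hn a h
end
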